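/- arXiv:1611.08488 — 5 statements merged into one kernel-verified Lean document; each statement's English description precedes it below -/
import Mathlib

section
/- Let X be a compact metric space with topological dimension dim X ≤ d and let T : X → X be a locally injective continuous map such that dim per_n(T) < n/2 for every n = 1, …, 2d. Then the set Ω = { f ∈ C(X, ℝ) : f observes T on (X × X) \ Δ_{2d}(T) in 2d steps } is residual (comeager) in C(X, ℝ) with the topology of uniform convergence. -/
open Set Topology Function

/-- `CovDimLE X d` : the topological (Lebesgue covering) dimension of `X` is at most `d`,
i.e. every open cover of `X` admits an open refinement covering `X` in which every point
belongs to at most `d + 1` sets. -/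
def CovDimLE (X : Type*) [TopologicalSpace X] (d : ℕ) : Prop :=
  ∀ 𝒰 : Set (Set X), (∀ U ∈ 𝒰, IsOpen U) → ⋃₀ 𝒰 = Set.univ →
    ∃ 𝒱 : Set (Set X), (∀ V ∈ 𝒱, IsOpen V) ∧ ⋃₀ 𝒱 = Set.univ ∧
      (∀ V ∈ 𝒱, ∃ U ∈ 𝒰, V ⊆ U) ∧
      ∀ x : X, {V ∈ 𝒱 | x ∈ V}.Finite ∧ Nat.card {V ∈ 𝒱 | x ∈ V} ≤ d + 1

theorem abs_sub_le_of_forall_dist_le {E ι : Type*} [Fintype ι] {F G : E → ι → ℝ} {δ : ℝ}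
    (h : ∀ x, dist (F x) (G x) ≤ δ) (i : ι) (x : E) : |F x i - G x i| ≤ δ :=
  (dist_le_pi_dist (F x) (G x) i).trans (h x)

theorem CovDimLE.of_isClosedEmbedding {E A : Type*} [TopologicalSpace E] [TopologicalSpace A]
    {k : ℕ} (hA : CovDimLE A k) {e : E → A} (he : IsClosedEmbedding e) : CovDimLE E k := by
  intro 𝒰 h𝒰 hcov
  obtain ⟨𝒱, h𝒱, hVcov, href, hord⟩ := hA
    ({U' : Set A | IsOpen U' ∧ e ⁻¹' U' ∈ 𝒰} ∪ {(range e)ᶜ}) (by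
      rintro U (hU | rfl)
      · exact hU.1
      · exact he.isClosed_range.isOpen_compl) (by
      refine eq_univ_of_forall fun a => ?_
      by_cases ha : a ∈ range e
      · obtain ⟨x, rfl⟩ := ha
        obtain ⟨U, hU, hxU⟩ : x ∈ ⋃₀ 𝒰 := hcov ▸ mem_univ x
        obtain ⟨U', hU', rfl⟩ := he.isInducing.isOpen_iff.1 (h𝒰 U hU)
        exact ⟨U', Or.inl ⟨hU', hU⟩, hxU⟩
      · exact ⟨_, Or.inr rfl, ha⟩)
  refine ⟨{W | (∃ V ∈ 𝒱, e ⁻¹' V = W) ∧ W.Nonempty}, ?_, ?_, ?_, ?_⟩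
  · rintro _ ⟨⟨V, hV, rfl⟩, -⟩
    exact (h𝒱 V hV).preimage he.continuous
  · refine eq_univ_of_forall fun x => ?_
    obtain ⟨V, hV, hxV⟩ : e x ∈ ⋃₀ 𝒱 := hVcov ▸ mem_univ _
    exact ⟨e ⁻¹' V, ⟨⟨V, hV, rfl⟩, x, hxV⟩, hxV⟩
  · rintro _ ⟨⟨V, hV, rfl⟩, x, hx⟩
    obtain ⟨U, hU | rfl, hVU⟩ := href V hV
    · exact ⟨_, hU.2, preimage_mono hVU⟩
    · exact absurd ⟨x, rfl⟩ (hVU hx)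
  · intro x
    obtain ⟨hfin, hcard⟩ := hord (e x)
    have hsub : {W | W ∈ {W | (∃ V ∈ 𝒱, e ⁻¹' V = W) ∧ W.Nonempty} ∧ x ∈ W} ⊆
        (fun V => e ⁻¹' V) '' {V | V ∈ 𝒱 ∧ e x ∈ V} := by
      rintro _ ⟨⟨⟨V, hV, rfl⟩, -⟩, hxV⟩
      exact ⟨V, ⟨hV, hxV⟩, rfl⟩
    refine ⟨(hfin.image _).subset hsub, ?_⟩
    calc _ ≤ _ := Set.ncard_le_ncard hsub (hfin.image _)
      _ ≤ _ := Set.ncard_image_le hfin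
      _ ≤ _ := hcard

/-- In a compact space of dimension at most `k`, a continuous map is approximated by the weights
of a finite partition of unity of order at most `k + 1`. -/
theorem CovDimLE.exists_partition {E V : Type*} [TopologicalSpace E] [CompactSpace E] [T2Space E]
    [PseudoMetricSpace V] {k : ℕ} (hE : CovDimLE E k) {F : E → V} (hF : Continuous F)
    {δ : ℝ} (hδ : 0 < δ) :
    ∃ (n : ℕ) (ψ : Fin n → C(E, ℝ)) (w : Fin n → V),
      (∀ i x, 0 ≤ ψ i x) ∧ (∀ x, ∑ i, ψ i x = 1) ∧
      (∀ x, (Finset.univ.filter fun i => ψ i x ≠ 0).card ≤ k + 1) ∧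
      ∀ i x, ψ i x ≠ 0 → dist (w i) (F x) < δ := by
  classical
  obtain ⟨𝒱, h𝒱, hVcov, href, hord⟩ := hE
    (range fun x => F ⁻¹' Metric.ball (F x) δ) (by
      rintro _ ⟨x, rfl⟩
      exact Metric.isOpen_ball.preimage hF) (by
      refine eq_univ_of_forall fun x => ⟨_, ⟨x, rfl⟩, ?_⟩
      simpa using hδ)
  obtain ⟨t, htcov⟩ := isCompact_univ.elim_finite_subcover (fun V : 𝒱 => (V : Set E))
    (fun V => h𝒱 V V.2) (by rw [← sUnion_eq_iUnion, hVcov])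
  let eq := t.equivFin
  let U : Fin t.card → Set E := fun i => ((eq.symm i : 𝒱) : Set E)
  have hUinj : Injective U := fun i j hij =>
    eq.symm.injective (Subtype.ext (Subtype.ext hij))
  have hU𝒱 : ∀ i, U i ∈ 𝒱 := fun i => (eq.symm i : 𝒱).2
  obtain ⟨ψ, hψ⟩ := PartitionOfUnity.exists_isSubordinate (isClosed_univ (X := E)) U
    (fun i => h𝒱 _ (hU𝒱 i)) (by
      intro x hx
      obtain ⟨V, hV, hxV⟩ := mem_iUnion₂.1 (htcov hx)
      exact mem_iUnion.2 ⟨eq ⟨V, hV⟩, by simpa [U] using hxV⟩)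
  have hsupp : ∀ i x, ψ i x ≠ 0 → x ∈ U i := fun i x h => hψ i (subset_tsupport _ h)
  have hw : ∀ i, ∃ w : V, ∀ x, ψ i x ≠ 0 → dist w (F x) < δ := by
    intro i
    obtain ⟨_, ⟨y, rfl⟩, hy⟩ := href _ (hU𝒱 i)
    exact ⟨F y, fun x hx => by simpa [dist_comm] using hy (hsupp i x hx)⟩
  choose w hw using hw
  refine ⟨t.card, fun i => ψ i, w, fun i x => ψ.nonneg i x, fun x => ?_, fun x => ?_, hw⟩
  · rw [← finsum_eq_sum_of_fintype]
    exact ψ.sum_eq_one (mem_univ x)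
  · obtain ⟨hfin, hcard⟩ := hord x
    refine le_trans ?_ hcard
    rw [← Finset.card_image_of_injective _ hUinj, ← Set.ncard_coe_finset]
    refine Set.ncard_le_ncard ?_ hfin
    intro W hW
    simp only [Finset.coe_image, Finset.coe_filter, Finset.mem_univ, true_and] at hW
    obtain ⟨i, hi, rfl⟩ := hW
    exact ⟨hU𝒱 i, hsupp i x hi⟩

theorem dist_sum_smul_le {ι V : Type*} [Fintype ι] [SeminormedAddCommGroup V] [NormedSpace ℝ V]
    {s : ι → ℝ} (h0 : ∀ i, 0 ≤ s i) (h1 : ∑ i, s i = 1) {v : ι → V} {z : V} {δ : ℝ}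
    (hv : ∀ i, s i ≠ 0 → dist (v i) z ≤ δ) : dist (∑ i, s i • v i) z ≤ δ := by
  have : ∑ i, s i • v i - z = ∑ i, s i • (v i - z) := by
    simp [smul_sub, Finset.sum_sub_distrib, ← Finset.sum_smul, h1]
  rw [dist_eq_norm, this]
  calc _ ≤ ∑ i, s i * δ := by
        refine norm_sum_le_of_le _ fun i _ => ?_
        rw [norm_smul, Real.norm_of_nonneg (h0 i)]
        by_cases hi : s i = 0
        · simp [hi]
        · exact mul_le_mul_of_nonneg_left (by simpa [dist_eq_norm] using hv i hi) (h0 i)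
    _ = δ := by rw [← Finset.sum_mul, h1, one_mul]

section GeneralPosition

variable {V : Type*} [NormedAddCommGroup V] [NormedSpace ℝ V]

theorem affineSpan_finset_ne_top {D : Finset V} (hD : D.card ≤ Module.finrank ℝ V) :
    affineSpan ℝ (D : Set V) ≠ ⊤ := by
  classical
  rcases D.eq_empty_or_nonempty with rfl | hne
  · simp [AffineSubspace.bot_ne_top ℝ V V]
  · intro h
    rw [AffineSubspace.affineSpan_eq_top_iff_vectorSpan_eq_top_of_nonempty ℝ V V (by simpa)] at h
    have h1 : 0 < D.card := hne.card_pos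
    have := finrank_vectorSpan_image_finset_le ℝ (id : V → V) D (n := D.card - 1) (by omega)
    rw [Finset.image_id, h, finrank_top] at this
    omega

variable [FiniteDimensional ℝ V]

theorem exists_dist_lt_notMem_affineSpan (B : Finset V) (w : V) {δ : ℝ} (hδ : 0 < δ) :
    ∃ u, dist u w < δ ∧ ∀ D ⊆ B, D.card ≤ Module.finrank ℝ V → u ∉ affineSpan ℝ (D : Set V) := by
  classical
  borelize V
  let μ : MeasureTheory.Measure V := MeasureTheory.Measure.addHaar
  let bad : Finset (Finset V) := B.powerset.filter fun D => D.card ≤ Module.finrank ℝ V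
  have hbad : μ (⋃ D ∈ bad, (affineSpan ℝ (D : Set V) : Set V)) = 0 := by
    refine (MeasureTheory.measure_biUnion_null_iff bad.countable_toSet).2 fun D hD => ?_
    exact MeasureTheory.Measure.addHaar_affineSubspace μ _
      (affineSpan_finset_ne_top (Finset.mem_filter.1 hD).2)
  have hne : (Metric.ball w δ \ ⋃ D ∈ bad, (affineSpan ℝ (D : Set V) : Set V)).Nonempty := by
    rw [Set.nonempty_iff_ne_empty, Ne, Set.sdiff_eq_empty]
    intro hsub
    exact (Metric.measure_ball_pos μ w hδ).ne' (MeasureTheory.measure_mono_null hsub hbad)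
  obtain ⟨u, hu, hu'⟩ := hne
  refine ⟨u, hu, fun D hD hcard hmem => hu' ?_⟩
  exact mem_iUnion₂.2 ⟨D, Finset.mem_filter.2 ⟨Finset.mem_powerset.2 hD, hcard⟩, hmem⟩

/-- Finitely many points can be moved slightly so that affine combinations of at most `k + 1` of
them avoid the affine span of any `c` points of a given finite set, when `k + c ≤ dim V`. -/
theorem exists_general_position {ι : Type*} (A : Finset ι) (w : ι → V)
    (C : Finset V) {k c : ℕ} (hkc : k + c ≤ Module.finrank ℝ V) {δ : ℝ} (hδ : 0 < δ) :
    ∃ v : ι → V, (∀ i, dist (v i) (w i) < δ) ∧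
      ∀ S ⊆ A, S.card ≤ k + 1 → ∀ s : ι → ℝ, ∑ i ∈ S, s i = 1 →
        ∀ C' ⊆ C, C'.card ≤ c → ∑ i ∈ S, s i • v i ∉ affineSpan ℝ (C' : Set V) := by
  classical
  induction A using Finset.induction_on with
  | empty =>
    refine ⟨w, fun i => by simpa using hδ, fun S hS _ s hs => ?_⟩
    obtain rfl := Finset.subset_empty.1 hS
    simp at hs
  | insert a A ha ih =>
    obtain ⟨v, hv, hvA⟩ := ih
    obtain ⟨u, hu, huB⟩ := exists_dist_lt_notMem_affineSpan (A.image v ∪ C) (w a) hδ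
    refine ⟨Function.update v a u, fun i => ?_, fun S hS hcard s hs C' hC' hC'card hmem => ?_⟩
    · rcases eq_or_ne i a with rfl | hi
      · simpa using hu
      · simpa [hi] using hv i
    have hSA : S.erase a ⊆ A := by
      intro i hi
      have := hS (Finset.mem_of_mem_erase hi)
      exact (Finset.mem_insert.1 this).resolve_left (Finset.ne_of_mem_erase hi)
    have hupd : ∑ i ∈ S.erase a, s i • Function.update v a u i = ∑ i ∈ S.erase a, s i • v i :=
      Finset.sum_congr rfl fun i hi => by rw [Function.update_of_ne (Finset.ne_of_mem_erase hi)]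
    by_cases h0 : a ∈ S ∧ s a ≠ 0
    · obtain ⟨haS, hsa⟩ := h0
      rw [← Finset.add_sum_erase _ _ haS] at hs
      rw [← Finset.add_sum_erase _ _ haS, hupd, Function.update_self] at hmem
      have hecard : (S.erase a).card ≤ k := by
        rw [Finset.card_erase_of_mem haS]; omega
      refine huB ((S.erase a).image v ∪ C')
        (Finset.union_subset_union (Finset.image_subset_image hSA) hC') ?_ ?_
      · calc _ ≤ _ := Finset.card_union_le _ _
          _ ≤ k + c := add_le_add (Finset.card_image_le.trans hecard) hC'card
          _ ≤ _ := hkc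
      set P := affineSpan ℝ (((S.erase a).image v ∪ C' : Finset V) : Set V) with hP
      set z := s a • u + ∑ i ∈ S.erase a, s i • v i with hz
      have hzP : z ∈ P := affineSpan_mono ℝ (by simp) hmem
      have hvP : ∀ i ∈ S.erase a, v i ∈ P := fun i hi =>
        subset_affineSpan ℝ _ (Finset.mem_coe.2
          (Finset.mem_union_left _ (Finset.mem_image_of_mem v hi)))
      have hdir : (s a)⁻¹ • ∑ i ∈ S.erase a, s i • (z - v i) ∈ P.direction :=
        P.direction.smul_mem _ (P.direction.sum_mem fun i hi =>
          P.direction.smul_mem _ (AffineSubspace.vsub_mem_direction hzP (hvP i hi)))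
      have hu_eq : (s a)⁻¹ • ∑ i ∈ S.erase a, s i • (z - v i) + z = u := by
        have h1 : ∑ i ∈ S.erase a, s i • (z - v i) = s a • (u - z) := by
          simp only [smul_sub, Finset.sum_sub_distrib, ← Finset.sum_smul]
          rw [show ∑ i ∈ S.erase a, s i = 1 - s a by linarith,
            show ∑ i ∈ S.erase a, s i • v i = z - s a • u by rw [hz]; abel]
          module
        rw [h1, inv_smul_smul₀ hsa, sub_add_cancel]
      have := AffineSubspace.vadd_mem_of_mem_direction hdir hzP
      rwa [vadd_eq_add, hu_eq] at this
    · have key : ∀ g : ι → ℝ, ∀ y : ι → V, (a ∈ S → g a = 0) →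
          ∑ i ∈ S, g i • y i = ∑ i ∈ S.erase a, g i • y i := by
        intro g y hg
        by_cases haS : a ∈ S
        · rw [← Finset.add_sum_erase _ _ haS, hg haS, zero_smul, zero_add]
        · rw [Finset.erase_eq_of_notMem haS]
      have hsa : a ∈ S → s a = 0 := fun h => by
        by_contra h'
        exact h0 ⟨h, h'⟩
      rw [key _ _ hsa, hupd] at hmem
      refine hvA (S.erase a) hSA ((Finset.card_le_card (Finset.erase_subset _ _)).trans hcard)
        s ?_ C' hC' hC'card hmem
      by_cases haS : a ∈ S
      · rw [← Finset.add_sum_erase _ _ haS, hsa haS, zero_add] at hs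
        exact hs
      · rwa [Finset.erase_eq_of_notMem haS]

end GeneralPosition

theorem CovDimLE.exists_approx_mem_affineSpan {E V : Type*} [TopologicalSpace E] [CompactSpace E]
    [T2Space E] [NormedAddCommGroup V] [NormedSpace ℝ V] {k : ℕ} (hE : CovDimLE E k) {G : E → V}
    (hG : Continuous G) {δ : ℝ} (hδ : 0 < δ) :
    ∃ (G' : E → V) (C : Finset V), Continuous G' ∧ (∀ x, dist (G' x) (G x) ≤ δ) ∧
      ∀ x, ∃ C' ⊆ C, C'.card ≤ k + 1 ∧ G' x ∈ affineSpan ℝ (C' : Set V) := by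
  classical
  obtain ⟨n, ψ, w, h0, h1, hcard, hw⟩ := hE.exists_partition hG hδ
  refine ⟨fun x => ∑ i, ψ i x • w i, Finset.univ.image w, by fun_prop, fun x => ?_, fun x => ?_⟩
  · exact dist_sum_smul_le (fun i => h0 i x) (h1 x) fun i hi => (hw i x hi).le
  · refine ⟨(Finset.univ.filter fun i => ψ i x ≠ 0).image w,
      Finset.image_subset_image (Finset.filter_subset _ _),
      Finset.card_image_le.trans (hcard x), convexHull_subset_affineSpan _ ?_⟩
    beta_reduce
    rw [← Finset.sum_filter_of_ne (s := Finset.univ) (f := fun i => ψ i x • w i)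
      (p := fun i => ψ i x ≠ 0) (fun i _ hi h => hi (by rw [h, zero_smul]))]
    refine (convex_convexHull ℝ _).sum_mem (fun i _ => h0 i x) ?_ fun i hi =>
      subset_convexHull ℝ _ (Finset.mem_coe.2 (Finset.mem_image_of_mem w hi))
    rw [Finset.sum_filter_of_ne (fun i _ hi => hi), h1]

/-- A continuous map from a compact space of dimension at most `k` can be moved slightly off all
affine spans of at most `c` points of a given finite set, when `k + c ≤ dim V`. -/
theorem CovDimLE.exists_approx_notMem_affineSpan {E V : Type*} [TopologicalSpace E]
    [CompactSpace E] [T2Space E] [NormedAddCommGroup V] [NormedSpace ℝ V] [FiniteDimensional ℝ V]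
    {k c : ℕ} (hE : CovDimLE E k) (hkc : k + c ≤ Module.finrank ℝ V) (C : Finset V) {F : E → V}
    (hF : Continuous F) {δ : ℝ} (hδ : 0 < δ) :
    ∃ F' : E → V, Continuous F' ∧ (∀ x, dist (F' x) (F x) ≤ δ) ∧
      ∀ x, ∀ C' ⊆ C, C'.card ≤ c → F' x ∉ affineSpan ℝ (C' : Set V) := by
  classical
  obtain ⟨n, ψ, w, h0, h1, hcard, hw⟩ := hE.exists_partition hF (half_pos hδ)
  obtain ⟨v, hv, hvC⟩ := exists_general_position Finset.univ w C hkc (half_pos hδ)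
  refine ⟨fun x => ∑ i, ψ i x • v i, by fun_prop, fun x => ?_, fun x C' hC' hC'c => ?_⟩
  · refine dist_sum_smul_le (fun i => h0 i x) (h1 x) fun i hi => ?_
    linarith [dist_triangle (v i) (w i) (F x), hv i, hw i x hi]
  · beta_reduce
    rw [← Finset.sum_filter_of_ne (s := Finset.univ) (f := fun i => ψ i x • v i)
      (p := fun i => ψ i x ≠ 0) (fun i _ hi h => hi (by rw [h, zero_smul]))]
    refine hvC _ (Finset.subset_univ _) (hcard x) (fun i => ψ i x) ?_ C' hC' hC'c
    rw [Finset.sum_filter_of_ne (fun i _ hi => hi), h1]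

theorem exists_triangular_solution {ι A : Type*} [SeminormedAddCommGroup A] (I : Set ι)
    (σ : ι → Option ι) (ρ : ι → ℕ) {M : ℕ} (hM : ∀ i, ρ i ≤ M)
    (hρ : ∀ i ∈ I, ∀ j, σ i = some j → ρ j < ρ i) (η : ι → A) {δ : ℝ} (hδ : 0 ≤ δ)
    (hη : ∀ i ∈ I, ‖η i‖ ≤ δ) :
    ∃ u : ι → A, (∀ i ∈ I, u i = η i + (σ i).elim 0 u) ∧ ∀ i, ‖u i‖ ≤ (M + 1) * δ := by
  classical
  let step : (ι → A) → ι → A := fun u i => if i ∈ I then η i + (σ i).elim 0 u else 0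
  let u : ℕ → ι → A := fun n => step^[n] 0
  have hu : ∀ n, u (n + 1) = step (u n) := fun n => Function.iterate_succ_apply' _ _ _
  have hnorm : ∀ n i, ‖u n i‖ ≤ n * δ := by
    intro n
    induction n with
    | zero => intro i; simp [u]
    | succ n ih =>
      intro i
      rw [hu]
      by_cases hi : i ∈ I
      · have h2 : ‖(σ i).elim 0 (u n)‖ ≤ n * δ := by
          cases σ i with
          | none => simpa using by positivity
          | some j => exact ih j
        simp only [step, if_pos hi]
        push_cast
        linarith [norm_add_le (η i) ((σ i).elim 0 (u n)), hη i hi]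
      · simp only [step, if_neg hi, norm_zero]
        positivity
  have hstab : ∀ n i, ρ i < n → u (n + 1) i = u n i := by
    intro n
    induction n with
    | zero => intro i h; omega
    | succ n ih =>
      intro i hi
      rw [hu (n + 1), hu n]
      by_cases hiI : i ∈ I
      · simp only [step, if_pos hiI]
        cases hσ : σ i with
        | none => rfl
        | some j =>
          have := hρ i hiI j hσ
          change η i + step (u n) j = η i + u n j
          rw [← hu, ih j (by omega)]
      · simp only [step, if_neg hiI]
  refine ⟨u (M + 1), fun i hi => ?_, fun i => by simpa using hnorm (M + 1) i⟩
  rw [← hstab (M + 1) i (by have := hM i; omega), hu (M + 1)]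
  simp only [step, if_pos hi]

theorem exists_extension_of_injective {X D : Type*} [TopologicalSpace X] [CompactSpace X]
    [T2Space X] [TopologicalSpace D] [CompactSpace D] {e : D → X} (he : Continuous e)
    (hinj : Injective e) {u : D → ℝ} (hu : Continuous u) {ε : ℝ} (hε : 0 ≤ ε)
    (hb : ∀ z, |u z| ≤ ε) : ∃ h : C(X, ℝ), ‖h‖ ≤ ε ∧ ∀ z, h (e z) = u z := by
  obtain ⟨g, hg, hge⟩ := BoundedContinuousFunction.exists_extension_norm_eq_of_isClosedEmbedding
    (BoundedContinuousFunction.mkOfCompact ⟨u, hu⟩) (he.isClosedEmbedding hinj)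
  refine ⟨g.toContinuousMap, (ContinuousMap.norm_le _ hε).2 fun x => ?_, fun z => congrFun hge z⟩
  refine (g.norm_coe_le_norm x).trans (hg.le.trans ?_)
  exact (BoundedContinuousFunction.norm_le hε).2 hb

/-- Two families of embedded spaces with small dimension: after a perturbation of the observable,
the values along the first family differ from those along the second. -/
theorem exists_approx_of_disjoint {X E E' : Type*} [TopologicalSpace X] [CompactSpace X] [T2Space X]
    [TopologicalSpace E] [CompactSpace E] [T2Space E] [TopologicalSpace E'] [CompactSpace E']
    [T2Space E'] {k k' m n : ℕ} (hE : CovDimLE E k) (hE' : CovDimLE E' k') (hm : k + k' < m)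
    {a : Fin m → E → X} (ha : ∀ i, Continuous (a i)) {b : Fin n → E' → X}
    (hb : ∀ i, Continuous (b i))
    (hinj : Injective (Sum.elim (fun z : Fin m × E => a z.1 z.2) fun z : Fin n × E' => b z.1 z.2))
    (τ : Fin m → Fin n) (f : C(X, ℝ)) {ε : ℝ} (hε : 0 < ε) :
    ∃ h : C(X, ℝ), ‖h‖ ≤ ε ∧ ∀ x y, ∃ i, (f + h) (a i x) ≠ (f + h) (b (τ i) y) := by
  classical
  obtain ⟨G, C, hG, hGf, hGC⟩ := hE'.exists_approx_mem_affineSpan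
    (G := fun y (j : Fin n) => f (b j y)) (by fun_prop) hε
  let L : (Fin n → ℝ) →ₗ[ℝ] (Fin m → ℝ) := LinearMap.funLeft ℝ ℝ τ
  obtain ⟨F, hF, hFf, hFC⟩ := hE.exists_approx_notMem_affineSpan (c := k' + 1)
    (by simp only [Module.finrank_fin_fun]; omega) (C.image L)
    (F := fun x (i : Fin m) => f (a i x)) (by fun_prop) hε
  obtain ⟨h, hh, hhe⟩ := exists_extension_of_injective
    (e := Sum.elim (fun z : Fin m × E => a z.1 z.2) fun z : Fin n × E' => b z.1 z.2)
    (continuous_sum_dom.2 ⟨continuous_prod_of_discrete_left.2 ha,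
      continuous_prod_of_discrete_left.2 hb⟩) hinj
    (u := Sum.elim (fun z => F z.2 z.1 - f (a z.1 z.2)) fun z => G z.2 z.1 - f (b z.1 z.2))
    (continuous_sum_dom.2 ⟨continuous_prod_of_discrete_left.2 fun i => by
        simp only [Function.comp_def, Sum.elim_inl]
        exact ((continuous_apply i).comp hF).sub (f.continuous.comp (ha i)),
      continuous_prod_of_discrete_left.2 fun i => by
        simp only [Function.comp_def, Sum.elim_inr]
        exact ((continuous_apply i).comp hG).sub (f.continuous.comp (hb i))⟩)
    hε.le (by
      rintro (⟨i, x⟩ | ⟨i, y⟩)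
      · exact (abs_sub_le_of_forall_dist_le hFf i x)
      · exact (abs_sub_le_of_forall_dist_le hGf i y))
  refine ⟨h, hh, fun x y => ?_⟩
  by_contra! hcon
  obtain ⟨C', hC', hcard, hmem⟩ := hGC y
  refine hFC x (C'.image L) (Finset.image_subset_image hC') (Finset.card_image_le.trans hcard) ?_
  have hFG : F x = L (G y) := by
    funext i
    have h1 := hhe (Sum.inl (i, x))
    have h2 := hhe (Sum.inr (τ i, y))
    have h3 := hcon i
    simp only [Sum.elim_inl, Sum.elim_inr, ContinuousMap.add_apply] at h1 h2 h3
    simp only [L, LinearMap.funLeft_apply]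
    linarith
  rw [hFG, Finset.coe_image]
  have := AffineSubspace.map_span L.toAffineMap (C' : Set (Fin n → ℝ))
  rw [LinearMap.coe_toAffineMap] at this
  rw [← this]
  exact AffineSubspace.mem_map_of_mem L.toAffineMap hmem

/-- One embedded family `a` of a space of small dimension, compared with a family `c` which along
the rows in `I` follows `a` in a triangular way, or stays in a set `Q` disjoint from `a`. -/
theorem exists_approx_of_triangular {X E : Type*} [TopologicalSpace X] [CompactSpace X] [T2Space X]
    [TopologicalSpace E] [CompactSpace E] [T2Space E] {k m : ℕ} (hE : CovDimLE E k)
    {a : Fin m → E → X} (ha : ∀ i, Continuous (a i))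
    (hinj : Injective fun z : Fin m × E => a z.1 z.2) {c : Fin m → E → X}
    (hc : ∀ i, Continuous (c i)) {Q : Set X} (hQ : IsClosed Q) (haQ : ∀ i x, a i x ∉ Q)
    (σ : Fin m → Option (Fin m)) (hσs : ∀ i j, σ i = some j → c i = a j)
    (hσn : ∀ i, σ i = none → ∀ x, c i x ∈ Q) (I : Finset (Fin m)) (hI : k < I.card)
    (ρ : Fin m → ℕ) (hρm : ∀ i, ρ i ≤ m) (hρ : ∀ i ∈ I, ∀ j, σ i = some j → ρ j < ρ i)
    (f : C(X, ℝ)) {ε : ℝ} (hε : 0 < ε) :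
    ∃ h : C(X, ℝ), ‖h‖ ≤ ε ∧ ∀ x, ∃ i, (f + h) (a i x) ≠ (f + h) (c i x) := by
  classical
  have hδ : 0 < ε / (m + 1) := by positivity
  obtain ⟨F, hF, hFf, hF0⟩ := hE.exists_approx_notMem_affineSpan (c := 1)
    (by simp only [Module.finrank_fintype_fun_eq_card, Fintype.card_coe]; omega) {0}
    (F := fun x (i : I) => f (a i x) - f (c i x)) (by fun_prop) hδ
  let η : Fin m → C(E, ℝ) := fun i =>
    if hi : i ∈ I then ⟨fun x => F x ⟨i, hi⟩ - (f (a i x) - f (c i x)), by fun_prop⟩ else 0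
  obtain ⟨u, hu, hun⟩ := exists_triangular_solution (I : Set (Fin m)) σ ρ hρm hρ η hδ.le (by
    intro i hi
    have hi' : i ∈ I := hi
    simp only [η, dif_pos hi']
    refine (ContinuousMap.norm_le _ hδ.le).2 fun x => ?_
    exact (abs_sub_le_of_forall_dist_le hFf ⟨i, hi'⟩ x))
  have hun' : ∀ i, ‖u i‖ ≤ ε := fun i => (hun i).trans_eq (by field_simp)
  have : CompactSpace Q := isCompact_iff_compactSpace.1 hQ.isCompact
  obtain ⟨h, hh, hhe⟩ := exists_extension_of_injective
    (e := Sum.elim (fun z : Fin m × E => a z.1 z.2) fun z : Q => (z : X))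
    (continuous_sum_dom.2 ⟨continuous_prod_of_discrete_left.2 ha, continuous_subtype_val⟩)
    (hinj.sumElim Subtype.val_injective fun z q hzq => haQ z.1 z.2 (hzq ▸ q.2))
    (u := Sum.elim (fun z => u z.1 z.2) fun _ => 0)
    (continuous_sum_dom.2 ⟨continuous_prod_of_discrete_left.2 fun i => (u i).continuous,
      continuous_const⟩) hε.le (by
      rintro (⟨i, x⟩ | q)
      · exact ((u i).norm_coe_le_norm x).trans (hun' i)
      · simpa using hε.le)
  refine ⟨h, hh, fun x => ?_⟩
  by_contra! hcon
  refine hF0 x {0} subset_rfl (by simp) ?_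
  have hF0' : F x = 0 := by
    funext i
    have h1 : h (a i x) = u i x := hhe (Sum.inl (i, x))
    have h2 : u i x = η i x + h (c i x) := by
      have h3 := congrArg (fun g : C(E, ℝ) => g x) (hu i i.2)
      simp only [ContinuousMap.add_apply] at h3
      rw [h3]
      congr 1
      cases hσ : σ i with
      | none => simpa using (hhe (Sum.inr ⟨c i x, hσn i hσ x⟩)).symm
      | some j => simpa [hσs i j hσ] using (hhe (Sum.inl (j, x))).symm
    have h4 : η i x = F x i - (f (a i x) - f (c i x)) := by
      simp [η, i.2]
    have h5 := hcon i
    simp only [ContinuousMap.add_apply] at h5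
    simp only [Pi.zero_apply]
    linarith
  simp [hF0']

/-- If no row of `c` follows the same row of `a`, then at least half of the rows follow `a`
in a triangular way (strictly upwards, or strictly downwards or not at all). -/
theorem exists_approx_of_ne_self {X E : Type*} [TopologicalSpace X] [CompactSpace X] [T2Space X]
    [TopologicalSpace E] [CompactSpace E] [T2Space E] {k m : ℕ} (hE : CovDimLE E k)
    (hm : 2 * k < m) {a : Fin m → E → X} (ha : ∀ i, Continuous (a i))
    (hinj : Injective fun z : Fin m × E => a z.1 z.2) {c : Fin m → E → X}
    (hc : ∀ i, Continuous (c i)) {Q : Set X} (hQ : IsClosed Q) (haQ : ∀ i x, a i x ∉ Q)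
    (σ : Fin m → Option (Fin m)) (hσs : ∀ i j, σ i = some j → c i = a j)
    (hσn : ∀ i, σ i = none → ∀ x, c i x ∈ Q) (hσi : ∀ i, σ i ≠ some i)
    (f : C(X, ℝ)) {ε : ℝ} (hε : 0 < ε) :
    ∃ h : C(X, ℝ), ‖h‖ ≤ ε ∧ ∀ x, ∃ i, (f + h) (a i x) ≠ (f + h) (c i x) := by
  classical
  have happ := exists_approx_of_triangular hE ha hinj hc hQ haQ σ hσs hσn
  let I : Finset (Fin m) := Finset.univ.filter fun i => ∃ j, σ i = some j ∧ i < j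
  have hcard : I.card + Iᶜ.card = m := by simp
  by_cases hI : k < I.card
  · refine happ I hI (fun i => m - i) (fun i => Nat.sub_le _ _) (fun i hi j hj => ?_) f hε
    obtain ⟨j', hj', hij⟩ := (Finset.mem_filter.1 hi).2
    obtain rfl : j = j' := Option.some_injective _ (hj.symm.trans hj')
    have : (i : ℕ) < j := hij
    omega
  · refine happ Iᶜ (by omega) (fun i => i) (fun i => i.2.le) (fun i hi j hj => ?_) f hε
    have h1 : ¬ i < j := fun hij =>
      Finset.mem_compl.1 hi (Finset.mem_filter.2 ⟨Finset.mem_univ _, j, hj, hij⟩)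
    have h2 : j ≠ i := fun h => hσi i (h ▸ hj)
    exact lt_of_le_of_ne (Fin.le_def.1 (not_lt.1 h1)) (Fin.val_ne_of_ne h2)

/-- All coincidences between the first `n` iterates of `a` and `b` persist for `x` and `y`. -/
def OrbitRel {X : Type*} (T : X → X) (n : ℕ) (a b x y : X) : Prop :=
  ∀ i ≤ n, ∀ j ≤ n, T^[i] a = T^[j] b → T^[i] x = T^[j] y

theorem OrbitRel.symm {X : Type*} {T : X → X} {n : ℕ} {a b x y : X} (h : OrbitRel T n a b x y) :
    OrbitRel T n b a y x :=
  fun i hi j hj hij => (h j hj i hi hij.symm).symm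

theorem isClosed_orbitRel {X Z : Type*} [TopologicalSpace X] [T2Space X] [TopologicalSpace Z]
    {T : X → X} (hT : Continuous T) (n : ℕ) (a b : X) {p q : Z → X} (hp : Continuous p)
    (hq : Continuous q) : IsClosed {z | OrbitRel T n a b (p z) (q z)} := by
  simp only [OrbitRel, ofPred_forall]
  exact isClosed_iInter fun i => isClosed_iInter fun _ => isClosed_iInter fun j =>
    isClosed_iInter fun _ => isClosed_iInter fun _ =>
      isClosed_eq ((hT.iterate i).comp hp) ((hT.iterate j).comp hq)

theorem exists_nhds_iterate_ne {X : Type*} [TopologicalSpace X] [T2Space X] {T : X → X}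
    (hT : Continuous T) (n : ℕ) (a b : X) :
    ∃ U ∈ 𝓝 a, ∃ V ∈ 𝓝 b, ∀ x ∈ U, ∀ y ∈ V, ∀ i ≤ n, ∀ j ≤ n,
      T^[i] a ≠ T^[j] b → T^[i] x ≠ T^[j] y := by
  have h : ∀ᶠ z : X × X in 𝓝 (a, b), ∀ i ∈ Iic n, ∀ j ∈ Iic n,
      T^[i] a ≠ T^[j] b → T^[i] z.1 ≠ T^[j] z.2 := by
    refine ((finite_Iic n).eventually_all).2 fun i _ => ((finite_Iic n).eventually_all).2
      fun j _ => ?_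
    by_cases hij : T^[i] a = T^[j] b
    · exact .of_forall fun z hz => absurd hij hz
    · have h1 : ContinuousAt (fun z : X × X => T^[i] z.1) (a, b) :=
        ((hT.iterate i).comp continuous_fst).continuousAt
      have h2 : ContinuousAt (fun z : X × X => T^[j] z.2) (a, b) :=
        ((hT.iterate j).comp continuous_snd).continuousAt
      filter_upwards [(h1.ne_iff_eventually_ne h2).1 hij] with z hz _ using hz
  rw [nhds_prod_eq] at h
  obtain ⟨U, hU, V, hV, hUV⟩ := Filter.mem_prod_iff.1 h
  exact ⟨U, hU, V, hV, fun x hx y hy => hUV (mk_mem_prod hx hy)⟩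

theorem exists_nhds_injOn_iterate {X : Type*} [TopologicalSpace X] {T : X → X}
    (hT : Continuous T) (hTloc : ∀ x : X, ∃ U ∈ 𝓝 x, InjOn T U) (n : ℕ) (x : X) :
    ∃ U ∈ 𝓝 x, InjOn T^[n] U := by
  induction n generalizing x with
  | zero => exact ⟨univ, Filter.univ_mem, injOn_id _⟩
  | succ n ih =>
    obtain ⟨U, hU, hUinj⟩ := hTloc x
    obtain ⟨V, hV, hVinj⟩ := ih (T x)
    refine ⟨U ∩ T ⁻¹' V, Filter.inter_mem hU (hT.continuousAt hV), ?_⟩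
    rw [Function.iterate_succ]
    exact hVinj.comp (hUinj.mono inter_subset_left) fun z hz => hz.2

theorem Set.InjOn.of_iterate_le {X : Type*} {T : X → X} {n i : ℕ} {U : Set X}
    (h : InjOn T^[n] U) (hi : i ≤ n) : InjOn T^[i] U := by
  intro x hx y hy hxy
  refine h hx hy ?_
  rw [← Nat.sub_add_cancel hi, Function.iterate_add_apply, Function.iterate_add_apply, hxy]

/-- The initial segment of distinct iterates of a point, among its first `n + 1` iterates. -/
theorem exists_distinct_iterates {X : Type*} (T : X → X) (n : ℕ) (x : X) :
    ∃ m ≤ n + 1, InjOn (fun i => T^[i] x) (Iio m) ∧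
      (∀ i ≤ n, ∃ j < m, T^[i] x = T^[j] x) ∧
      (m = n + 1 ∨ m ≤ n ∧ ∃ a < m, T^[m] x = T^[a] x) := by
  classical
  by_cases hinj : InjOn (fun i => T^[i] x) (Iio (n + 1))
  · exact ⟨n + 1, le_rfl, hinj, fun i hi => ⟨i, by omega, rfl⟩, Or.inl rfl⟩
  have hex : ∃ m, ∃ a < m, T^[m] x = T^[a] x := by
    simp only [InjOn, not_forall] at hinj
    obtain ⟨i, -, j, -, hij, hne⟩ := hinj
    rcases lt_or_gt_of_ne hne with h | h
    · exact ⟨j, i, h, hij.symm⟩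
    · exact ⟨i, j, h, hij⟩
  have hmin : InjOn (fun i => T^[i] x) (Iio (Nat.find hex)) := by
    intro i hi j hj hij
    by_contra hne
    rcases lt_or_gt_of_ne hne with h | h
    · exact Nat.find_min hex hj ⟨i, h, hij.symm⟩
    · exact Nat.find_min hex hi ⟨j, h, hij⟩
  have hle : Nat.find hex ≤ n := by
    by_contra hlt
    exact hinj (hmin.mono (Iio_subset_Iio (by omega)))
  obtain ⟨a, ha, hax⟩ := Nat.find_spec hex
  refine ⟨Nat.find hex, by omega, hmin, fun i _ => ?_, Or.inr ⟨hle, a, ha, hax⟩⟩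
  induction i using Nat.strong_induction_on with
  | _ i ih =>
    by_cases hi : i < Nat.find hex
    · exact ⟨i, hi, rfl⟩
    · obtain ⟨t, rfl⟩ := Nat.exists_eq_add_of_le (not_lt.1 hi)
      obtain ⟨j, hj, hjx⟩ := ih (t + a) (by omega) (by omega)
      refine ⟨j, hj, ?_⟩
      rw [← hjx, add_comm, Function.iterate_add_apply, hax, ← Function.iterate_add_apply]

section Dynamics

variable {X : Type*} [MetricSpace X] [CompactSpace X]

/-- If `x₀` has `m` distinct iterates then, near `x₀`, the points with at least the coincidences
of the orbit of `x₀` form a set of dimension less than `m / 2`. -/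
theorem exists_dim_lt_distinct_iterates (d : ℕ) {T : X → X} (hT : Continuous T)
    (hdim : CovDimLE X d)
    (hper : ∀ n : ℕ, 1 ≤ n → n ≤ 2 * d → ∃ k : ℕ, 2 * k < n ∧
      CovDimLE {x : X | ∃ j : ℕ, 1 ≤ j ∧ j ≤ n ∧ T^[j] x = x} k) (x₀ : X) :
    ∃ m k, 2 * k < m ∧ m ≤ 2 * d + 1 ∧ InjOn (fun i => T^[i] x₀) (Iio m) ∧
      (∀ i ≤ 2 * d, ∃ j < m, T^[i] x₀ = T^[j] x₀) ∧
      ∀ A, IsClosed A → InjOn T^[2 * d] A → (∀ x ∈ A, OrbitRel T (2 * d) x₀ x₀ x x) →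
        CovDimLE A k := by
  obtain ⟨m, hm, hinj, hred, rfl | ⟨hle, a, ha, hax⟩⟩ := exists_distinct_iterates T (2 * d) x₀
  · exact ⟨_, d, by omega, le_rfl, hinj, hred, fun A hA _ _ =>
      hdim.of_isClosedEmbedding hA.isClosedEmbedding_subtypeVal⟩
  · obtain ⟨k, hk, hkper⟩ := hper (m - a) (by omega) (by omega)
    refine ⟨m, k, by omega, hm, hinj, hred, fun A hA hAinj hArel => ?_⟩
    have : CompactSpace A := isCompact_iff_compactSpace.1 hA.isCompact
    let e : A → {x : X | ∃ j : ℕ, 1 ≤ j ∧ j ≤ m - a ∧ T^[j] x = x} := fun x =>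
      ⟨T^[a] x, m - a, by omega, le_rfl, by
        rw [← Function.iterate_add_apply, Nat.sub_add_cancel ha.le]
        exact hArel x x.2 m hle a (by omega) hax⟩
    have he : Continuous e := ((hT.iterate a).comp continuous_subtype_val).subtype_mk _
    refine hkper.of_isClosedEmbedding (he.isClosedEmbedding fun x y hxy => ?_)
    exact Subtype.ext (hAinj.of_iterate_le (by omega) x.2 y.2 (congrArg Subtype.val hxy))

theorem exists_nhds_approx_of_le {n : ℕ} {T : X → X} (hT : Continuous T)
    (hTloc : ∀ x : X, ∃ U ∈ 𝓝 x, InjOn T U) {x₀ y₀ : X} (hne : T^[n] x₀ ≠ T^[n] y₀)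
    {m k m' k' : ℕ} (hmm' : m' ≤ m) (hm : m ≤ n + 1) (hk : 2 * k < m) (hk' : 2 * k' < m')
    (hx₀ : InjOn (fun i => T^[i] x₀) (Iio m)) (hy₀ : InjOn (fun i => T^[i] y₀) (Iio m'))
    (hy₀' : ∀ i ≤ n, ∃ j < m', T^[i] y₀ = T^[j] y₀)
    (hdx : ∀ A, IsClosed A → InjOn T^[n] A → (∀ x ∈ A, OrbitRel T n x₀ x₀ x x) → CovDimLE A k)
    (hdy : ∀ A, IsClosed A → InjOn T^[n] A → (∀ y ∈ A, OrbitRel T n y₀ y₀ y y) → CovDimLE A k') :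
    ∃ K ∈ 𝓝 x₀, ∃ L ∈ 𝓝 y₀, IsClosed K ∧ IsClosed L ∧ ∀ (f : C(X, ℝ)) (ε : ℝ), 0 < ε →
      ∃ h : C(X, ℝ), ‖h‖ ≤ ε ∧ ∀ x ∈ K, ∀ y ∈ L, OrbitRel T n x₀ x₀ x x →
        OrbitRel T n y₀ y₀ y y → OrbitRel T n x₀ y₀ x y →
          ∃ i ≤ n, (f + h) (T^[i] x) ≠ (f + h) (T^[i] y) := by
  have hne' : ∀ i ≤ n, T^[i] x₀ ≠ T^[i] y₀ := fun i hi h => hne (by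
    rw [← Nat.sub_add_cancel hi, Function.iterate_add_apply, Function.iterate_add_apply, h])
  obtain ⟨A, hA, A', hA', hAA'⟩ := exists_nhds_iterate_ne hT n x₀ x₀
  obtain ⟨B, hB, B', hB', hBB'⟩ := exists_nhds_iterate_ne hT n y₀ y₀
  obtain ⟨P, hP, Q, hQ, hPQ⟩ := exists_nhds_iterate_ne hT n x₀ y₀
  obtain ⟨U, hU, hUinj⟩ := exists_nhds_injOn_iterate hT hTloc n x₀
  obtain ⟨V, hV, hVinj⟩ := exists_nhds_injOn_iterate hT hTloc n y₀
  obtain ⟨K, hK, hKc, hKs⟩ := exists_mem_nhds_isClosed_subset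
    (Filter.inter_mem (Filter.inter_mem hA hA') (Filter.inter_mem hP hU))
  obtain ⟨L, hL, hLc, hLs⟩ := exists_mem_nhds_isClosed_subset
    (Filter.inter_mem (Filter.inter_mem hB hB') (Filter.inter_mem hQ hV))
  have hKinj : InjOn T^[n] K := hUinj.mono fun x hx => (hKs hx).2.2
  have hLinj : InjOn T^[n] L := hVinj.mono fun x hx => (hLs hx).2.2
  have hKdisj : ∀ x ∈ K, ∀ x' ∈ K, ∀ i < m, ∀ j < m, T^[i] x = T^[j] x' → i = j ∧ x = x' := by
    intro x hx x' hx' i hi j hj hij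
    have : i = j := by
      by_contra h
      exact hAA' x (hKs hx).1.1 x' (hKs hx').1.2 i (by omega) j (by omega)
        (fun h' => h (hx₀ hi hj h')) hij
    subst this
    exact ⟨rfl, hKinj.of_iterate_le (by omega) hx hx' hij⟩
  have hLdisj : ∀ y ∈ L, ∀ y' ∈ L, ∀ i < m', ∀ j < m', T^[i] y = T^[j] y' → i = j ∧ y = y' := by
    intro x hx x' hx' i hi j hj hij
    have : i = j := by
      by_contra h
      exact hBB' x (hLs hx).1.1 x' (hLs hx').1.2 i (by omega) j (by omega)
        (fun h' => h (hy₀ hi hj h')) hij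
    subst this
    exact ⟨rfl, hLinj.of_iterate_le (by omega) hx hx' hij⟩
  have hKL : ∀ x ∈ K, ∀ y ∈ L, ∀ i ≤ n, ∀ j ≤ n, T^[i] x₀ ≠ T^[j] y₀ → T^[i] x ≠ T^[j] y :=
    fun x hx y hy => hPQ x (hKs hx).2.1 y (hLs hy).2.1
  refine ⟨K, hK, L, hL, hKc, hLc, fun f ε hε => ?_⟩
  let Ex : Set X := K ∩ {x | OrbitRel T n x₀ x₀ x x}
  have hExc : IsClosed Ex := hKc.inter (isClosed_orbitRel hT n _ _ continuous_id continuous_id)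
  have hExd : CovDimLE Ex k := hdx Ex hExc (hKinj.mono inter_subset_left) fun x hx => hx.2
  have : CompactSpace Ex := isCompact_iff_compactSpace.1 hExc.isCompact
  by_cases hco : ∃ a ≤ n, ∃ b ≤ n, T^[a] x₀ = T^[b] y₀
  · obtain ⟨a, ha, b, hb, hab⟩ := hco
    let E : Set (X × X) := {z | z.1 ∈ K ∧ z.2 ∈ L ∧ OrbitRel T n x₀ x₀ z.1 z.1 ∧
      OrbitRel T n x₀ y₀ z.1 z.2}
    have hEc : IsClosed E := (hKc.preimage continuous_fst).inter
      ((hLc.preimage continuous_snd).inter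
        ((isClosed_orbitRel hT n _ _ continuous_fst continuous_fst).inter
          (isClosed_orbitRel hT n _ _ continuous_fst continuous_snd)))
    have : CompactSpace E := isCompact_iff_compactSpace.1 hEc.isCompact
    have hEfst : ∀ z ∈ E, ∀ z' ∈ E, z.1 = z'.1 → z = z' := by
      rintro ⟨x, y⟩ ⟨_, hy, _, hxy⟩ ⟨x', y'⟩ ⟨_, hy', _, hxy'⟩ (rfl : x = x')
      have h1 := hxy a ha b hb hab
      have h2 := hxy' a ha b hb hab
      exact Prod.ext rfl (hLinj.of_iterate_le hb hy hy' (h1.symm.trans h2))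
    let e : E → Ex := fun z => ⟨z.1.1, z.2.1, z.2.2.2.1⟩
    have he : Continuous e := (continuous_fst.comp continuous_subtype_val).subtype_mk _
    have hEd : CovDimLE E k := hExd.of_isClosedEmbedding (he.isClosedEmbedding fun z z' hzz' =>
      Subtype.ext (hEfst z z.2 z' z'.2 (congrArg Subtype.val hzz')))
    have hσ : ∀ i : Fin m, ∃ o : Option (Fin m), (∀ j, o = some j → T^[j] x₀ = T^[i] y₀) ∧
        (o = none → ∀ j : Fin m, T^[j] x₀ ≠ T^[i] y₀) := by
      intro i
      by_cases h : ∃ j : Fin m, T^[j] x₀ = T^[i] y₀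
      · obtain ⟨j, hj⟩ := h
        exact ⟨some j, by rintro _ ⟨⟩; exact hj, by simp⟩
      · exact ⟨none, by simp, fun _ j hj => h ⟨j, hj⟩⟩
    choose σ hσs hσn using hσ
    obtain ⟨h, hh, hsep⟩ := exists_approx_of_ne_self hEd hk
      (a := fun i z => T^[i] z.1.1)
      (fun i => (hT.iterate i).comp (continuous_fst.comp continuous_subtype_val))
      (fun ⟨i, z⟩ ⟨j, z'⟩ hij => by
        obtain ⟨h1, h2⟩ := hKdisj _ z.2.1 _ z'.2.1 i i.2 j j.2 hij
        exact Prod.ext (Fin.ext h1) (Subtype.ext (hEfst z z.2 z' z'.2 h2)))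
      (c := fun i z => T^[i] z.1.2)
      (fun i => (hT.iterate i).comp (continuous_snd.comp continuous_subtype_val))
      (Q := ⋃ i ∈ {i : Fin m | σ i = none}, T^[i] '' L)
      ((toFinite _).isClosed_biUnion fun i _ =>
        (hLc.isCompact.image (hT.iterate i)).isClosed)
      (fun i z hz => by
        obtain ⟨j, hj, y, hy, hyz⟩ := mem_iUnion₂.1 hz
        exact hKL _ z.2.1 y hy i (by omega) j (by omega) (hσn j hj i) hyz.symm)
      σ
      (fun i j hij => funext fun z =>
        (z.2.2.2.2 j (by omega) i (by omega) (hσs i j hij)).symm)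
      (fun i hi z => mem_iUnion₂.2 ⟨i, hi, z.1.2, z.2.2.1, rfl⟩)
      (fun i hi => hne' i (by omega) (hσs i i hi)) f hε
    refine ⟨h, hh, fun x hx y hy hxx _ hxy => ?_⟩
    obtain ⟨i, hi⟩ := hsep ⟨(x, y), hx, hy, hxx, hxy⟩
    exact ⟨i, by omega, hi⟩
  · push Not at hco
    let Ey : Set X := L ∩ {y | OrbitRel T n y₀ y₀ y y}
    have hEyc : IsClosed Ey := hLc.inter (isClosed_orbitRel hT n _ _ continuous_id continuous_id)
    have hEyd : CovDimLE Ey k' := hdy Ey hEyc (hLinj.mono inter_subset_left) fun y hy => hy.2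
    have : CompactSpace Ey := isCompact_iff_compactSpace.1 hEyc.isCompact
    have hτ : ∀ i : Fin m, ∃ j : Fin m', T^[i] y₀ = T^[j] y₀ := fun i => by
      obtain ⟨j, hj, hij⟩ := hy₀' i (by omega)
      exact ⟨⟨j, hj⟩, hij⟩
    choose τ hτ using hτ
    obtain ⟨h, hh, hsep⟩ := exists_approx_of_disjoint hExd hEyd (m := m) (n := m') (by omega)
      (a := fun i x => T^[i] x) (fun i => (hT.iterate i).comp continuous_subtype_val)
      (b := fun i y => T^[i] y) (fun i => (hT.iterate i).comp continuous_subtype_val)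
      (Injective.sumElim
        (fun ⟨i, x⟩ ⟨j, x'⟩ hij => by
          obtain ⟨h1, h2⟩ := hKdisj _ x.2.1 _ x'.2.1 i i.2 j j.2 hij
          exact Prod.ext (Fin.ext h1) (Subtype.ext h2))
        (fun ⟨i, x⟩ ⟨j, x'⟩ hij => by
          obtain ⟨h1, h2⟩ := hLdisj _ x.2.1 _ x'.2.1 i i.2 j j.2 hij
          exact Prod.ext (Fin.ext h1) (Subtype.ext h2))
        fun ⟨i, x⟩ ⟨j, y⟩ => hKL _ x.2.1 _ y.2.1 i (by omega) j (by omega)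
          (hco i (by omega) j (by omega))) τ f hε
    refine ⟨h, hh, fun x hx y hy hxx hyy _ => ?_⟩
    obtain ⟨i, hi⟩ := hsep ⟨x, hx, hxx⟩ ⟨y, hy, hyy⟩
    refine ⟨i, by omega, ?_⟩
    rwa [hyy i (by omega) (τ i) (by omega) (hτ i)]

theorem exists_nhds_dense (d : ℕ) {T : X → X} (hT : Continuous T)
    (hTloc : ∀ x : X, ∃ U ∈ 𝓝 x, InjOn T U) (hdim : CovDimLE X d)
    (hper : ∀ n : ℕ, 1 ≤ n → n ≤ 2 * d → ∃ k : ℕ, 2 * k < n ∧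
      CovDimLE {x : X | ∃ j : ℕ, 1 ≤ j ∧ j ≤ n ∧ T^[j] x = x} k) {x₀ y₀ : X}
    (hne : T^[2 * d] x₀ ≠ T^[2 * d] y₀) :
    ∃ K ∈ 𝓝 x₀, ∃ L ∈ 𝓝 y₀, IsClosed K ∧ IsClosed L ∧
      Dense {f : C(X, ℝ) | ∀ x ∈ K, ∀ y ∈ L, OrbitRel T (2 * d) x₀ x₀ x x →
        OrbitRel T (2 * d) y₀ y₀ y y → OrbitRel T (2 * d) x₀ y₀ x y →
          ∃ i ≤ 2 * d, f (T^[i] x) ≠ f (T^[i] y)} := by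
  suffices H : ∃ K ∈ 𝓝 x₀, ∃ L ∈ 𝓝 y₀, IsClosed K ∧ IsClosed L ∧ ∀ (f : C(X, ℝ)) (ε : ℝ), 0 < ε →
      ∃ h : C(X, ℝ), ‖h‖ ≤ ε ∧ ∀ x ∈ K, ∀ y ∈ L, OrbitRel T (2 * d) x₀ x₀ x x →
        OrbitRel T (2 * d) y₀ y₀ y y → OrbitRel T (2 * d) x₀ y₀ x y →
          ∃ i ≤ 2 * d, (f + h) (T^[i] x) ≠ (f + h) (T^[i] y) by
    obtain ⟨K, hK, L, hL, hKc, hLc, H⟩ := H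
    refine ⟨K, hK, L, hL, hKc, hLc, Metric.dense_iff.2 fun f ε hε => ?_⟩
    obtain ⟨h, hh, hsep⟩ := H f (ε / 2) (half_pos hε)
    refine ⟨f + h, ?_, hsep⟩
    rw [Metric.mem_ball, dist_eq_norm, add_sub_cancel_left]
    linarith
  obtain ⟨m, k, hk, hm, hx, hx', hdx⟩ := exists_dim_lt_distinct_iterates d hT hdim hper x₀
  obtain ⟨m', k', hk', hm', hy, hy', hdy⟩ :=
    exists_dim_lt_distinct_iterates d hT hdim hper y₀
  rcases le_total m' m with hmm' | hmm'
  · exact exists_nhds_approx_of_le hT hTloc hne hmm' hm hk hk' hx hy hy' hdx hdy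
  · obtain ⟨L, hL, K, hK, hLc, hKc, H⟩ :=
      exists_nhds_approx_of_le hT hTloc hne.symm hmm' hm' hk' hk hy hx hx' hdy hdx
    refine ⟨K, hK, L, hL, hKc, hLc, fun f ε hε => ?_⟩
    obtain ⟨h, hh, hsep⟩ := H f ε hε
    refine ⟨h, hh, fun x hx y hy hxx hyy hxy => ?_⟩
    obtain ⟨i, hi, hne⟩ := hsep y hy x hx hyy hxx hxy.symm
    exact ⟨i, hi, hne.symm⟩

end Dynamics

theorem isOpen_setOf_forall_exists_apply_ne {X Y : Type*} [TopologicalSpace X] [CompactSpace X]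
    [TopologicalSpace Y] [CompactSpace Y] {n : ℕ} {p q : ℕ → Y → X} (hp : ∀ i, Continuous (p i))
    (hq : ∀ i, Continuous (q i)) :
    IsOpen {f : C(X, ℝ) | ∀ z, ∃ i ≤ n, f (p i z) ≠ f (q i z)} := by
  have hcl : IsClosed {w : C(X, ℝ) × Y | ∀ i ≤ n, w.1 (p i w.2) = w.1 (q i w.2)} := by
    simp only [ofPred_forall]
    refine isClosed_iInter fun i => isClosed_iInter fun _ => isClosed_eq ?_ ?_
    · exact continuous_eval.comp (continuous_fst.prodMk ((hp i).comp continuous_snd))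
    · exact continuous_eval.comp (continuous_fst.prodMk ((hq i).comp continuous_snd))
  convert (isClosedMap_fst_of_compactSpace _ hcl).isOpen_compl using 1
  ext f
  simp

/-- Theorem: for a locally injective continuous map `T` of a compact metric space `X` with
`dim X ≤ d` and `dim perₙ(T) < n/2` for `n = 1, …, 2d`, a residual set of `f ∈ C(X, ℝ)`
observes `T` on `(X × X) \ Δ_{2d}(T)` in `2d` steps. -/
theorem stmt0 {X : Type*} [MetricSpace X] [CompactSpace X] (d : ℕ)
    (T : X → X) (hTcont : Continuous T)
    (hTloc : ∀ x : X, ∃ U ∈ 𝓝 x, Set.InjOn T U)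
    (hdim : CovDimLE X d)
    (hper : ∀ n : ℕ, 1 ≤ n → n ≤ 2 * d →
      ∃ k : ℕ, 2 * k < n ∧
        CovDimLE {x : X | ∃ j : ℕ, 1 ≤ j ∧ j ≤ n ∧ T^[j] x = x} k) :
    {f : C(X, ℝ) | ∀ x y : X, T^[2 * d] x ≠ T^[2 * d] y →
        ∃ i : ℕ, i ≤ 2 * d ∧ f (T^[i] x) ≠ f (T^[i] y)} ∈ residual C(X, ℝ) := by
  classical
  let P : X × X → Set (X × X) := fun z => {w | OrbitRel T (2 * d) z.1 z.1 w.1 w.1 ∧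
    OrbitRel T (2 * d) z.2 z.2 w.2 w.2 ∧ OrbitRel T (2 * d) z.1 z.2 w.1 w.2}
  let W : Set (X × X) := {z | T^[2 * d] z.1 ≠ T^[2 * d] z.2}
  let code : X × X → (Fin (2 * d + 1) → Fin (2 * d + 1) → Prop) × (Fin (2 * d + 1) →
      Fin (2 * d + 1) → Prop) × (Fin (2 * d + 1) → Fin (2 * d + 1) → Prop) := fun z =>
    (fun i j => T^[i] z.1 = T^[j] z.1, fun i j => T^[i] z.2 = T^[j] z.2,
      fun i j => T^[i] z.1 = T^[j] z.2)
  have hcode : ∀ z w, code z = code w → w ∈ P z := by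
    intro z w h
    simp only [code, Prod.mk.injEq, funext_iff] at h
    exact ⟨fun i hi j hj => (h.1 ⟨i, by omega⟩ ⟨j, by omega⟩).mp,
      fun i hi j hj => (h.2.1 ⟨i, by omega⟩ ⟨j, by omega⟩).mp,
      fun i hi j hj => (h.2.2 ⟨i, by omega⟩ ⟨j, by omega⟩).mp⟩
  have hloc : ∀ z ∈ W, ∃ O ∈ 𝓝 z, {f : C(X, ℝ) | ∀ w ∈ O ∩ P z,
      ∃ i ≤ 2 * d, f (T^[i] w.1) ≠ f (T^[i] w.2)} ∈ residual C(X, ℝ) := by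
    intro z hz
    obtain ⟨K, hK, L, hL, hKc, hLc, hdense⟩ := exists_nhds_dense d hTcont hTloc hdim hper hz
    refine ⟨K ×ˢ L, prod_mem_nhds hK hL, residual_of_dense_open ?_ ?_⟩
    · have hc : IsClosed (K ×ˢ L ∩ P z) := (hKc.prod hLc).inter
        ((isClosed_orbitRel hTcont _ _ _ continuous_fst continuous_fst).inter
          ((isClosed_orbitRel hTcont _ _ _ continuous_snd continuous_snd).inter
            (isClosed_orbitRel hTcont _ _ _ continuous_fst continuous_snd)))
      have : CompactSpace (K ×ˢ L ∩ P z : Set (X × X)) :=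
        isCompact_iff_compactSpace.1 hc.isCompact
      simpa using isOpen_setOf_forall_exists_apply_ne (n := 2 * d)
        (p := fun i (w : (K ×ˢ L ∩ P z : Set (X × X))) => T^[i] w.1.1)
        (q := fun i w => T^[i] w.1.2)
        (fun i => (hTcont.iterate i).comp (continuous_fst.comp continuous_subtype_val))
        (fun i => (hTcont.iterate i).comp (continuous_snd.comp continuous_subtype_val))
    · refine Dense.mono ?_ hdense
      intro f hf w hw
      exact hf _ hw.1.1 _ hw.1.2 hw.2.1 hw.2.2.1 hw.2.2.2
  choose! O hO hOres using hloc
  have hcover : ∀ c, ∃ t ⊆ {z ∈ W | code z = c}, t.Countable ∧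
      {z ∈ W | code z = c} ⊆ ⋃ z ∈ t, O z := fun c =>
    TopologicalSpace.countable_cover_nhdsWithin fun z hz =>
      mem_nhdsWithin_of_mem_nhds (hO z hz.1)
  choose t htW htc htcov using hcover
  have hmem : (⋂ c, ⋂ z ∈ t c, {f : C(X, ℝ) | ∀ w ∈ O z ∩ P z,
      ∃ i ≤ 2 * d, f (T^[i] w.1) ≠ f (T^[i] w.2)}) ∈ residual C(X, ℝ) :=
    countable_iInter_mem.2 fun c => (countable_bInter_mem (htc c)).2 fun z hz =>
      hOres z (htW c hz).1
  refine Filter.mem_of_superset hmem fun f hf x y hxy => ?_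
  obtain ⟨z, hz, hxyz⟩ := mem_iUnion₂.1 (htcov (code (x, y)) ⟨hxy, rfl⟩)
  exact mem_iInter₂.1 (mem_iInter.1 hf (code (x, y))) z hz (x, y)
    ⟨hxyz, hcode _ _ (htW _ hz).2⟩
end

section
/- Let X be a compact metric space with topological dimension dim X ≤ d and let T : X → X be an injective continuous map such that dim per_n(T) < n/2 for every n = 1, …, 2d. Then the set Ω = { f ∈ C(X, ℝ) : f observes T in 2d steps } is residual (comeager) in C(X, ℝ) with the topology of uniform convergence. -/
open Set Topology Function

namespace CovDimLE

/-- Covering dimension does not increase along closed embeddings. -/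
theorem of_isClosedEmbedding_s1 {Y Z : Type*} [TopologicalSpace Y] [TopologicalSpace Z] {k : ℕ}
    (h : CovDimLE Y k) {e : Z → Y} (he : IsClosedEmbedding e) : CovDimLE Z k := by
  intro 𝒰 hU hcov
  obtain ⟨𝒱, hV, hVcov, hVref, hVcard⟩ :=
    h ({V | IsOpen V ∧ ∃ U ∈ 𝒰, e ⁻¹' V ⊆ U} ∪ {(range e)ᶜ})
      (by
        rintro V (hV | rfl)
        · exact hV.1
        · exact he.isClosed_range.isOpen_compl)
      (by
        refine eq_univ_of_forall fun y => ?_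
        by_cases hy : y ∈ range e
        · obtain ⟨z, rfl⟩ := hy
          obtain ⟨U, hUU, hz⟩ : z ∈ ⋃₀ 𝒰 := hcov ▸ mem_univ z
          obtain ⟨V, hVo, rfl⟩ := he.isInducing.isOpen_iff.1 (hU U hUU)
          exact ⟨V, Or.inl ⟨hVo, _, hUU, Subset.rfl⟩, hz⟩
        · exact ⟨_, Or.inr rfl, hy⟩)
  refine ⟨(fun V => e ⁻¹' V) '' {V ∈ 𝒱 | (V ∩ range e).Nonempty}, ?_, ?_, ?_, ?_⟩
  · rintro _ ⟨V, hVV, rfl⟩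
    exact (hV V hVV.1).preimage he.continuous
  · refine eq_univ_of_forall fun z => ?_
    obtain ⟨V, hVV, hz⟩ : e z ∈ ⋃₀ 𝒱 := hVcov ▸ mem_univ (e z)
    exact ⟨_, ⟨V, ⟨hVV, e z, hz, mem_range_self z⟩, rfl⟩, hz⟩
  · rintro _ ⟨V, ⟨hVV, y, hyV, hy⟩, rfl⟩
    obtain ⟨U, hUU | rfl, hVU⟩ := hVref V hVV
    · obtain ⟨-, U', hU', hsub⟩ := hUU
      exact ⟨U', hU', (preimage_mono hVU).trans hsub⟩
    · exact absurd hy (hVU hyV)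
  · intro z
    have hsub : {W ∈ (fun V => e ⁻¹' V) '' {V ∈ 𝒱 | (V ∩ range e).Nonempty} | z ∈ W} ⊆
        (fun V => e ⁻¹' V) '' {V ∈ 𝒱 | e z ∈ V} := by
      rintro _ ⟨⟨V, hVV, rfl⟩, hz⟩
      exact ⟨V, ⟨hVV.1, hz⟩, rfl⟩
    obtain ⟨hfin, hcard⟩ := hVcard (e z)
    refine ⟨(hfin.image _).subset hsub, ?_⟩
    rw [Nat.card_coe_set_eq] at hcard ⊢
    exact (ncard_le_ncard hsub (hfin.image _)).trans ((ncard_image_le hfin).trans hcard)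

/-- Covering dimension does not increase on passing to closed subsets. -/
theorem mono_of_isClosed {X : Type*} [TopologicalSpace X] {s t : Set X} {k : ℕ}
    (h : CovDimLE t k) (hst : s ⊆ t) (hs : IsClosed s) : CovDimLE s k := by
  refine h.of_isClosedEmbedding_s1 (e := inclusion hst) ⟨.inclusion hst, ?_⟩
  rw [range_inclusion]
  exact hs.preimage continuous_subtype_val

/-- A continuous map on a compact Hausdorff space of dimension at most `a` is uniformly
approximated by continuous maps into finitely many affine subspaces of dimension at most `a`. -/
theorem exists_approx {Z E : Type*} [TopologicalSpace Z] [CompactSpace Z] [T2Space Z]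
    [NormedAddCommGroup E] [NormedSpace ℝ E] {a : ℕ} (h : CovDimLE Z a) (φ : C(Z, E))
    {ε : ℝ} (hε : 0 < ε) :
    ∃ φ' : C(Z, E), (∀ z, dist (φ' z) (φ z) < ε) ∧
      ∃ 𝒮 : Set (AffineSubspace ℝ E), 𝒮.Finite ∧
        (∀ S ∈ 𝒮, Module.finrank ℝ S.direction ≤ a) ∧ ∀ z, ∃ S ∈ 𝒮, φ' z ∈ S := by
  classical
  obtain ⟨𝒱, hV, hVcov, hVref, hVcard⟩ :=
    h (range fun c : E => φ ⁻¹' Metric.ball c ε)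
      (by rintro _ ⟨c, rfl⟩; exact Metric.isOpen_ball.preimage φ.continuous)
      (eq_univ_of_forall fun z => ⟨_, ⟨φ z, rfl⟩, by simpa using hε⟩)
  obtain ⟨t, htV, htfin, htcov⟩ := (isCompact_univ (X := Z)).elim_finite_subcover_image
    (b := 𝒱) (c := id) hV (by rw [← hVcov, sUnion_eq_biUnion]; rfl)
  replace htcov : univ ⊆ ⋃₀ t := by rwa [sUnion_eq_biUnion]
  have := htfin.fintype
  choose c hc using fun V : t => hVref V (htV V.2)
  have hc' : ∀ V : t, ∃ p : E, (V : Set Z) ⊆ φ ⁻¹' Metric.ball p ε := by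
    intro V
    obtain ⟨⟨p, hp⟩, hsub⟩ := hc V
    exact ⟨p, hsub.trans hp.ge⟩
  choose p hp using hc'
  obtain ⟨ρ, hρ⟩ := PartitionOfUnity.exists_isSubordinate (isClosed_univ (X := Z))
    (fun V : t => (V : Set Z)) (fun V => hV V (htV V.2))
    (by rw [← sUnion_eq_iUnion]; exact htcov)
  have hmem : ∀ V z, ρ V z ≠ 0 → z ∈ (V : Set Z) :=
    fun V z hz => hρ V (subset_tsupport _ hz)
  refine ⟨⟨fun z => ∑ V : t, ρ V z • p V, by fun_prop⟩, ?_,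
    (fun J : Finset t => affineSpan ℝ (J.image p : Set E)) '' {J | J.card ≤ a + 1 ∧ J.Nonempty},
    (toFinite _).image _, ?_, ?_⟩
  · intro z
    have := ρ.finsum_smul_mem_convex (g := fun V _ => p V) (x := z) (mem_univ z)
      (t := Metric.ball (φ z) ε)
      (fun V hz => by
        have := hp V (hmem V z hz)
        rw [mem_preimage, Metric.mem_ball, dist_comm] at this
        exact this) (convex_ball _ _)
    rwa [finsum_eq_sum_of_fintype] at this
  · rintro _ ⟨J, ⟨hJ, hne⟩, rfl⟩
    rw [direction_affineSpan]
    exact (finrank_vectorSpan_image_finset_le ℝ p J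
      (Nat.succ_pred_eq_of_pos hne.card_pos).symm).trans (Nat.sub_le_iff_le_add.2 hJ)
  · intro z
    obtain ⟨hfin, hcard⟩ := hVcard z
    refine ⟨_, ⟨Finset.univ.filter fun V : t => z ∈ (V : Set Z), ⟨?_, ?_⟩, rfl⟩, ?_⟩
    · rw [Nat.card_coe_set_eq] at hcard
      refine le_trans ?_ hcard
      rw [← Finset.card_image_of_injective _ Subtype.val_injective, ← ncard_coe_finset]
      refine ncard_le_ncard ?_ hfin
      intro V hVm
      obtain ⟨W, hW, rfl⟩ := Finset.mem_image.1 (Finset.mem_coe.1 hVm)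
      exact ⟨htV W.2, (Finset.mem_filter.1 hW).2⟩
    · obtain ⟨V, hVt, hz⟩ := htcov (mem_univ z)
      exact ⟨⟨V, hVt⟩, by simpa using hz⟩
    · have := ρ.finsum_smul_mem_convex (g := fun V _ => p V) (x := z) (mem_univ z)
        (t := (affineSpan ℝ
          ((Finset.univ.filter fun V : t => z ∈ (V : Set Z)).image p : Set E) : Set E))
        (fun V hz => subset_affineSpan ℝ _ (by
          rw [Finset.coe_image]
          exact ⟨V, by simpa using hmem V z hz, rfl⟩))
        (AffineSubspace.convex _)
      rwa [finsum_eq_sum_of_fintype] at this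

end CovDimLE

/-- Sums of points of finitely many affine subspaces of small total dimension are avoided by
arbitrarily small vectors. -/
theorem exists_norm_lt_forall_sum_ne {κ F : Type*} {E : κ → Type*} [Fintype κ]
    [NormedAddCommGroup F] [NormedSpace ℝ F] [FiniteDimensional ℝ F]
    [∀ k, AddCommGroup (E k)] [∀ k, Module ℝ (E k)] [∀ k, FiniteDimensional ℝ (E k)]
    (L : ∀ k, E k →ₗ[ℝ] F) (𝒮 : ∀ k, Set (AffineSubspace ℝ (E k))) (a : κ → ℕ)
    (hfin : ∀ k, (𝒮 k).Finite) (ha : ∀ k, ∀ S ∈ 𝒮 k, Module.finrank ℝ S.direction ≤ a k)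
    (hlt : ∑ k, a k < Module.finrank ℝ F) {ε : ℝ} (hε : 0 < ε) :
    ∃ δ : F, ‖δ‖ < ε ∧ ∀ p : ∀ k, E k, (∀ k, ∃ S ∈ 𝒮 k, p k ∈ S) → ∑ k, L k (p k) ≠ δ := by
  classical
  borelize F
  set μ : MeasureTheory.Measure F := MeasureTheory.Measure.addHaar
  have hnull : μ (⋃ S ∈ univ.pi 𝒮, {δ | ∃ p : ∀ k, E k, (∀ k, p k ∈ S k) ∧
      ∑ k, L k (p k) = δ}) = 0 := by
    rw [MeasureTheory.measure_biUnion_null_iff (Set.Finite.pi hfin).countable]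
    intro S hS
    rcases eq_empty_or_nonempty {δ | ∃ p : ∀ k, E k, (∀ k, p k ∈ S k) ∧ ∑ k, L k (p k) = δ} with
      h0 | ⟨_, p₀, hp₀, -⟩
    · rw [h0, MeasureTheory.measure_empty]
    let Λ : (∀ k, (S k).direction) →ₗ[ℝ] F :=
      ∑ k, (L k ∘ₗ (S k).direction.subtype) ∘ₗ LinearMap.proj k
    refine MeasureTheory.measure_mono_null ?_ (MeasureTheory.Measure.addHaar_affineSubspace μ
      (AffineSubspace.mk' (∑ k, L k (p₀ k)) (LinearMap.range Λ)) ?_)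
    · rintro _ ⟨p, hp, rfl⟩
      rw [SetLike.mem_coe, AffineSubspace.mem_mk']
      refine ⟨fun k => ⟨p k - p₀ k, AffineSubspace.vsub_mem_direction (hp k) (hp₀ k)⟩, ?_⟩
      simp [Λ, Finset.sum_sub_distrib]
    · intro htop
      have hr : LinearMap.range Λ = ⊤ := by
        rw [← AffineSubspace.direction_mk' (∑ k, L k (p₀ k)) (LinearMap.range Λ), htop,
          AffineSubspace.direction_top]
      have h1 := LinearMap.finrank_range_le Λ
      rw [hr, finrank_top, Module.finrank_pi_fintype] at h1
      have h2 : ∑ k, Module.finrank ℝ (S k).direction ≤ ∑ k, a k :=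
        Finset.sum_le_sum fun k _ => ha k _ (hS k (mem_univ k))
      omega
  have hdense := MeasureTheory.Measure.dense_of_ae
    (MeasureTheory.measure_eq_zero_iff_ae_notMem.1 hnull)
  obtain ⟨δ, hδ, hlt⟩ := hdense.exists_dist_lt 0 hε
  refine ⟨δ, by simpa using hlt, fun p hp hsum => hδ ?_⟩
  choose S hS hpS using hp
  exact mem_biUnion (fun k _ => hS k) ⟨p, hpS, hsum⟩

/-- Given a symmetric irreflexive relation on a finite set without isolated points, at least half
of the points can be chosen so that each of them is related to a point that is not chosen. -/
theorem Finset.exists_two_mul_card_ge_forall_exists_notMem {α : Type*} {r : α → α → Prop}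
    (hsymm : ∀ u v, r u v → r v u) (hirr : ∀ v, ¬ r v v) (V : Finset α)
    (hV : ∀ v ∈ V, ∃ u ∈ V, r v u) :
    ∃ S : Finset α, V.card ≤ 2 * S.card ∧ ∀ s ∈ S, ∃ u, u ∉ S ∧ r s u := by
  classical
  obtain ⟨D, ⟨hDV, hD⟩, hmin⟩ := exists_minimal_of_wellFoundedLT
    (fun D : Finset α => D ⊆ V ∧ ∀ v ∈ V \ D, ∃ u ∈ D, r v u) ⟨V, Subset.rfl, by simp⟩
  have hout : ∀ v ∈ D, ∃ u ∈ V \ D, r v u := by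
    intro v hv
    by_contra! hcon
    have hsub := @hmin (D.erase v) ⟨(D.erase_subset v).trans hDV, fun w hw => ?_⟩
      (D.erase_subset v)
    · exact D.notMem_erase v (hsub hv)
    rw [Finset.mem_sdiff, Finset.mem_erase, not_and_or, not_not] at hw
    by_cases hwv : w = v
    · subst hwv
      obtain ⟨u, hu, hwu⟩ := hV w hw.1
      have huD : u ∈ D := by
        by_contra huD
        exact hcon u (Finset.mem_sdiff.2 ⟨hu, huD⟩) hwu
      exact ⟨u, Finset.mem_erase.2 ⟨fun h => hirr w (h ▸ hwu), huD⟩, hwu⟩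
    · have hwD : w ∉ D := hw.2.resolve_left hwv
      have hwm := Finset.mem_sdiff.2 ⟨hw.1, hwD⟩
      obtain ⟨u, hu, hwu⟩ := hD w hwm
      exact ⟨u, Finset.mem_erase.2 ⟨fun h => hcon w hwm (hsymm _ _ (h ▸ hwu)), hu⟩, hwu⟩
  have hcard := Finset.card_sdiff_add_card_eq_card hDV
  rcases le_total D.card (V \ D).card with hle | hle
  · refine ⟨V \ D, by omega, fun s hs => ?_⟩
    obtain ⟨u, hu, hsu⟩ := hD s hs
    exact ⟨u, by simp [hu], hsu⟩
  · refine ⟨D, by omega, fun s hs => ?_⟩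
    obtain ⟨u, hu, hsu⟩ := hout s hs
    exact ⟨u, (Finset.mem_sdiff.1 hu).2, hsu⟩

section Perturbation

variable {X κ W : Type*} [MetricSpace X] [CompactSpace X] [Fintype κ] [Fintype W]
  {A : κ → Set X} {D : κ → ℕ} {comp : W → κ} {e : W → X → X}

/-- Perturbing a function near the copies `e s '' A (comp s)`, `s ∈ S`, makes its values there
differ from those on the unperturbed copies, for at least one `s` at a time, as soon as `S` has
more elements than the total dimension of the sets `A k`. -/
theorem exists_dist_lt_forall_exists_ne_of_notMem (hA : ∀ k, IsClosed (A k))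
    (hD : ∀ k, CovDimLE (A k) (D k)) (he : ∀ v, Continuous (e v)) (hinj : ∀ v, Injective (e v))
    (hdisj : ∀ v w, v ≠ w → ∀ z ∈ A (comp v), ∀ z' ∈ A (comp w), e v z ≠ e w z')
    (S : Finset W) (hS : ∑ k, D k < S.card) (c : W → W) (hc : ∀ s ∈ S, c s ∉ S)
    (f : C(X, ℝ)) {ε : ℝ} (hε : 0 < ε) :
    ∃ g : C(X, ℝ), dist g f < ε ∧ ∀ z : ∀ k, A k,
      ∃ s ∈ S, g (e s (z (comp s))) ≠ g (e (c s) (z (comp (c s)))) := by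
  classical
  have hcomp : ∀ k, CompactSpace (A k) := fun k => isCompact_iff_compactSpace.1 (hA k).isCompact
  have hε4 : 0 < ε / 4 := by positivity
  choose φ hφ 𝒮 hfin hdim hmem using fun k => (hD k).exists_approx
    (⟨fun (z : A k) (v : W) => f (e v z), by fun_prop⟩ : C(A k, W → ℝ)) hε4
  let L : κ → (W → ℝ) →ₗ[ℝ] (S → ℝ) := fun k => LinearMap.pi fun s =>
    (if comp (c s) = k then (LinearMap.proj (c s) : (W → ℝ) →ₗ[ℝ] ℝ) else 0) -
      (if comp s = k then LinearMap.proj (s : W) else 0)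
  obtain ⟨δ, hδ, hne⟩ := exists_norm_lt_forall_sum_ne L 𝒮 D hfin hdim
    (by simpa using hS) hε4
  let η : W → ℝ := fun v => if hv : v ∈ S then δ ⟨v, hv⟩ else 0
  have hη : ∀ v, |η v| < ε / 4 := by
    intro v
    by_cases hv : v ∈ S
    · simpa [η, hv] using (norm_le_pi_norm δ ⟨v, hv⟩).trans_lt hδ
    · simpa [η, hv] using hε
  let ι : (Σ v, A (comp v)) → X := fun p => e p.1 p.2
  have hι : IsClosedEmbedding ι := by
    refine Continuous.isClosedEmbedding
      (continuous_sigma fun v => (he v).comp continuous_subtype_val) ?_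
    rintro ⟨v, z⟩ ⟨w, z'⟩ h
    by_cases hvw : v = w
    · subst hvw
      exact congrArg (Sigma.mk v) (Subtype.ext (hinj v h))
    · exact absurd h (hdisj v w hvw z z.2 z' z'.2)
  let h : C(Σ v, A (comp v), ℝ) := ⟨fun p => φ (comp p.1) p.2 p.1 + η p.1 - f (e p.1 p.2), by
    refine continuous_sigma fun v => ?_
    have hφv : Continuous fun z : A (comp v) => φ (comp v) z v :=
      (continuous_apply v).comp (φ _).continuous
    have hfv : Continuous fun z : A (comp v) => f (e v z) :=
      f.continuous.comp ((he v).comp continuous_subtype_val)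
    have hsum : Continuous fun z : A (comp v) => φ (comp v) z v + η v - f (e v z) := by fun_prop
    exact hsum⟩
  have hh : ∀ p, h p ∈ Icc (-(ε / 2)) (ε / 2) := by
    rintro ⟨v, z⟩
    have h1 : |φ (comp v) z v - f (e v z)| < ε / 4 := by
      have := (dist_le_pi_dist _ _ v).trans_lt (hφ (comp v) z)
      simpa [Real.dist_eq] using this
    have h2 := hη v
    rw [abs_lt] at h1 h2
    constructor <;> simp only [h, ContinuousMap.coe_mk] <;> linarith
  obtain ⟨G, hG, hGι⟩ := h.exists_extension_forall_mem_of_isClosedEmbedding hh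
    ⟨0, by constructor <;> linarith⟩ hι
  have hval : ∀ v, ∀ z : A (comp v), (f + G) (e v z) = φ (comp v) z v + η v := by
    intro v z
    have : G (e v z) = h ⟨v, z⟩ := congrFun hGι ⟨v, z⟩
    simp [this, h]
  refine ⟨f + G, ?_, fun z => ?_⟩
  · rw [ContinuousMap.dist_lt_iff hε]
    intro x
    have := hG x
    rw [mem_Icc] at this
    rw [Real.dist_eq, ContinuousMap.add_apply, add_sub_cancel_left, abs_lt]
    constructor <;> linarith
  · by_contra! hcon
    refine hne (fun k => φ k (z k)) (fun k => hmem k (z k)) (funext fun s => ?_)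
    have hs := hcon s s.2
    rw [hval, hval] at hs
    have h1 : η s = δ s := by simp [η]
    have h2 : η (c s) = 0 := by simp [η, hc s s.2]
    rw [h1, h2] at hs
    have hL : ∀ k, L k (φ k (z k)) s = (if comp (c s) = k then φ k (z k) (c s) else 0) -
        (if comp s = k then φ k (z k) s else 0) := by
      intro k
      simp only [L, LinearMap.pi_apply, LinearMap.sub_apply]
      congr 1 <;> split_ifs <;> rfl
    rw [Finset.sum_apply, Finset.sum_congr rfl fun k _ => hL k, Finset.sum_sub_distrib,
      Finset.sum_ite_eq, Finset.sum_ite_eq]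
    simp only [Finset.mem_univ, if_true]
    linarith

/-- Functions separating, for each choice of points `z k ∈ A k`, at least one of the pairs
`(e (P i) _, e (Q i) _)` are dense, if the copies involved are more than twice as many as the
total dimension of the sets `A k`. -/
theorem exists_dist_lt_forall_exists_ne {I : Type*} (hA : ∀ k, IsClosed (A k))
    (hD : ∀ k, CovDimLE (A k) (D k)) (he : ∀ v, Continuous (e v)) (hinj : ∀ v, Injective (e v))
    (hdisj : ∀ v w, v ≠ w → ∀ z ∈ A (comp v), ∀ z' ∈ A (comp w), e v z ≠ e w z')
    (P Q : I → W) (hPQ : ∀ i, P i ≠ Q i)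
    (V : Finset W) (hV : ∀ v, v ∈ V ↔ v ∈ range P ∪ range Q) (hcard : 2 * ∑ k, D k < V.card)
    (f : C(X, ℝ)) {ε : ℝ} (hε : 0 < ε) :
    ∃ g : C(X, ℝ), dist g f < ε ∧ ∀ z : ∀ k, A k,
      ∃ i, g (e (P i) (z (comp (P i)))) ≠ g (e (Q i) (z (comp (Q i)))) := by
  classical
  obtain ⟨S, hS, hSr⟩ := V.exists_two_mul_card_ge_forall_exists_notMem
    (r := fun u v => ∃ i, (P i = u ∧ Q i = v) ∨ (P i = v ∧ Q i = u))
    (fun u v ⟨i, hi⟩ => ⟨i, hi.symm⟩)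
    (fun v ⟨i, hi⟩ => by rcases hi with ⟨h1, h2⟩ | ⟨h1, h2⟩ <;> exact hPQ i (h1.trans h2.symm))
    (fun v hv => by
      rcases (hV v).1 hv with ⟨i, rfl⟩ | ⟨i, rfl⟩
      · exact ⟨Q i, (hV _).2 (Or.inr ⟨i, rfl⟩), i, Or.inl ⟨rfl, rfl⟩⟩
      · exact ⟨P i, (hV _).2 (Or.inl ⟨i, rfl⟩), i, Or.inr ⟨rfl, rfl⟩⟩)
  choose! c hc hcr using hSr
  obtain ⟨g, hg, hgz⟩ := exists_dist_lt_forall_exists_ne_of_notMem hA hD he hinj hdisj S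
    (by omega) c hc f hε
  refine ⟨g, hg, fun z => ?_⟩
  obtain ⟨s, hs, hne⟩ := hgz z
  obtain ⟨i, ⟨h1, h2⟩ | ⟨h1, h2⟩⟩ := hcr s hs
  · exact ⟨i, by rwa [h1, h2]⟩
  · exact ⟨i, by rw [h1, h2]; exact hne.symm⟩

end Perturbation

/-- Residuality of a condition indexed by a subset of a second countable space is local. -/
theorem residual_setOf_forall_of_nhdsWithin {Y F : Type*} [TopologicalSpace Y]
    [SecondCountableTopology Y] [TopologicalSpace F] {s : Set Y} {p : Y → F → Prop}
    (h : ∀ y ∈ s, ∃ K ∈ 𝓝[s] y, {f | ∀ z ∈ K, p z f} ∈ residual F) :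
    {f | ∀ y ∈ s, p y f} ∈ residual F := by
  choose! K hK hres using h
  obtain ⟨t, hts, htc, hcov⟩ := TopologicalSpace.countable_cover_nhdsWithin hK
  refine Filter.mem_of_superset
    ((countable_bInter_mem htc).2 fun y hy => hres y (hts hy)) fun f hf y hy => ?_
  obtain ⟨x, hx, hyx⟩ := mem_iUnion₂.1 (hcov hy)
  exact mem_iInter₂.1 hf x hx y hyx

/-- The functions separating the orbit segments of length `N` of all pairs in a compact family
form an open set; so they are residual once they are dense. -/
theorem residual_setOf_forall_exists_iterate_ne {X Y : Type*} [MetricSpace X] [CompactSpace X]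
    [TopologicalSpace Y] {T : X → X} (hT : Continuous T) {a b : Y → X} (ha : Continuous a)
    (hb : Continuous b) {K : Set Y} (hK : IsCompact K) {N : ℕ}
    (hdense : ∀ (f : C(X, ℝ)) (ε : ℝ), 0 < ε → ∃ g : C(X, ℝ), dist g f < ε ∧
      ∀ y ∈ K, ∃ i : ℕ, i ≤ N ∧ g (T^[i] (a y)) ≠ g (T^[i] (b y))) :
    {f : C(X, ℝ) | ∀ y ∈ K, ∃ i : ℕ, i ≤ N ∧ f (T^[i] (a y)) ≠ f (T^[i] (b y))} ∈
      residual C(X, ℝ) := by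
  refine residual_of_dense_open (isOpen_iff_eventually.2 fun f hf => ?_)
    (Metric.dense_iff.2 fun f ε hε => ?_)
  · refine hK.eventually_forall_of_forall_eventually fun y hy => ?_
    obtain ⟨i, hi, hne⟩ := hf y hy
    have hTi := hT.iterate i
    have hopen : IsOpen {q : C(X, ℝ) × Y | q.1 (T^[i] (a q.2)) ≠ q.1 (T^[i] (b q.2))} :=
      isOpen_ne_fun (by fun_prop) (by fun_prop)
    filter_upwards [hopen.mem_nhds (show (f, y) ∈ _ from hne)] with q hq using ⟨i, hi, hq⟩
  · obtain ⟨g, hg, hgK⟩ := hdense f ε hε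
    exact ⟨g, hg, hgK⟩

section Orbits

variable {X : Type*} {T : X → X}

/-- The points `x` whose orbit segment up to time `N` is determined modulo `n`. -/
def iterateModSet (T : X → X) (N n : ℕ) : Set X :=
  {x | ∀ i ≤ N, T^[i] x = T^[i % n] x}

/-- The points of `iterateModSet T N n` whose first `n` iterates are distinct. -/
def exactIterateModSet (T : X → X) (N n : ℕ) : Set X :=
  {x | x ∈ iterateModSet T N n ∧ ∀ i < n, ∀ j < n, T^[i] x = T^[j] x → i = j}

theorem exists_mem_exactIterateModSet (hT : Injective T) (N : ℕ) (x : X) :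
    ∃ n, 1 ≤ n ∧ n ≤ N + 1 ∧ x ∈ exactIterateModSet T N n := by
  classical
  have hex : ∃ n, 1 ≤ n ∧ (T^[n] x = x ∨ n = N + 1) := ⟨N + 1, by omega, Or.inr rfl⟩
  obtain ⟨h1, h2⟩ := Nat.find_spec hex
  have hmin : ∀ m < Nat.find hex, 1 ≤ m → T^[m] x ≠ x := fun m hm hm1 hx =>
    Nat.find_min hex hm ⟨hm1, Or.inl hx⟩
  have hlt : ∀ i < Nat.find hex, ∀ j < i, T^[i] x ≠ T^[j] x := by
    intro i hi j hj hij
    refine hmin (i - j) (by omega) (by omega) (hT.iterate j ?_)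
    rw [← iterate_add_apply, Nat.add_sub_cancel' hj.le, hij]
  refine ⟨Nat.find hex, h1, Nat.find_min' hex ⟨by omega, Or.inr rfl⟩, fun i hi => ?_,
    fun i hi j hj hij => ?_⟩
  · rcases h2 with h2 | h2
    · exact (IsPeriodicPt.iterate_mod_apply h2 i).symm
    · rw [Nat.mod_eq_of_lt (by omega)]
  · rcases lt_trichotomy i j with h | h | h
    · exact absurd hij.symm (hlt j hj i h)
    · exact h
    · exact absurd hij (hlt i hi j h)

variable [MetricSpace X]

theorem isClosed_iterateModSet (hT : Continuous T) (N n : ℕ) :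
    IsClosed (iterateModSet T N n) := by
  have : iterateModSet T N n = ⋂ i ∈ Iic N, {x | T^[i] x = T^[i % n] x} := by
    ext
    simp [iterateModSet]
  rw [this]
  exact isClosed_biInter fun i _ => isClosed_eq (hT.iterate i) (hT.iterate _)

theorem exists_isClosed_mem_nhdsWithin_iterateModSet (hT : Continuous T) (N n : ℕ) (x : X)
    {U : X → Set X} (hU : ∀ y, y ∈ U y ∧ IsOpen (U y)) :
    ∃ A, IsClosed A ∧ A ⊆ iterateModSet T N n ∧ A ∈ 𝓝[iterateModSet T N n] x ∧
      ∀ i ≤ N, ∀ z ∈ A, T^[i] z ∈ U (T^[i] x) := by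
  have hnhds : (⋂ i ∈ Iic N, T^[i] ⁻¹' U (T^[i] x)) ∈ 𝓝 x :=
    (Filter.biInter_mem (finite_Iic N)).2 fun i _ =>
      ((hU _).2.preimage (hT.iterate i)).mem_nhds (hU _).1
  obtain ⟨C, hC, hCc, hCs⟩ := exists_mem_nhds_isClosed_subset hnhds
  exact ⟨iterateModSet T N n ∩ C, (isClosed_iterateModSet hT N n).inter hCc, inter_subset_left,
    inter_mem_nhdsWithin _ hC, fun i hi z hz => mem_iInter₂.1 (hCs hz.2) i hi⟩

variable {d : ℕ}

theorem exists_covDimLE_of_subset_iterateModSet (hdim : CovDimLE X d)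
    (hper : ∀ n : ℕ, 1 ≤ n → n ≤ 2 * d →
      ∃ k : ℕ, 2 * k < n ∧ CovDimLE {x : X | ∃ j : ℕ, 1 ≤ j ∧ j ≤ n ∧ T^[j] x = x} k)
    {n : ℕ} (hn : 1 ≤ n) :
    ∃ k, 2 * k < min n (2 * d + 1) ∧
      ∀ A ⊆ iterateModSet T (4 * d) n, IsClosed A → CovDimLE A k := by
  by_cases hnd : n ≤ 2 * d
  · obtain ⟨k, hk, hdimk⟩ := hper n hn hnd
    refine ⟨k, by omega, fun A hA hAc => hdimk.mono_of_isClosed (fun x hx => ?_) hAc⟩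
    refine ⟨n, hn, le_rfl, ?_⟩
    simpa using hA hx n (by omega)
  · exact ⟨d, by omega, fun A _ hAc => hdim.of_isClosedEmbedding_s1 hAc.isClosedEmbedding_subtypeVal⟩

variable [CompactSpace X]

theorem residual_separating_same_orbit (hT : Continuous T) (hTinj : Injective T)
    (hdim : CovDimLE X d)
    (hper : ∀ n : ℕ, 1 ≤ n → n ≤ 2 * d →
      ∃ k : ℕ, 2 * k < n ∧ CovDimLE {x : X | ∃ j : ℕ, 1 ≤ j ∧ j ≤ n ∧ T^[j] x = x} k)
    {n l : ℕ} (hn : 1 ≤ n) (hnd : n ≤ 4 * d + 1) (hl : l ≤ 2 * d) :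
    {f : C(X, ℝ) | ∀ x ∈ {x | x ∈ exactIterateModSet T (4 * d) n ∧ T^[l] x ≠ x},
      ∃ i : ℕ, i ≤ 2 * d ∧ f (T^[i] x) ≠ f (T^[i] (T^[l] x))} ∈ residual C(X, ℝ) := by
  classical
  refine residual_setOf_forall_of_nhdsWithin fun x hx => ?_
  obtain ⟨⟨hxY, hxinj⟩, hxl⟩ := hx
  obtain ⟨U, hU, hUdisj⟩ := ((finite_Iic (4 * d)).image fun i => T^[i] x).t2_separation
  obtain ⟨A, hAc, hAY, hAn, hAU⟩ := exists_isClosed_mem_nhdsWithin_iterateModSet hT _ n _ hU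
  refine ⟨A, nhdsWithin_mono _ (fun z hz => hz.1.1) hAn, ?_⟩
  obtain ⟨k, hk, hkA⟩ := exists_covDimLE_of_subset_iterateModSet hdim hper hn
  refine residual_setOf_forall_exists_iterate_ne hT continuous_id (hT.iterate l) hAc.isCompact
    fun f ε hε => ?_
  let P : Fin (2 * d + 1) → Fin n := fun i => ⟨i % n, Nat.mod_lt _ hn⟩
  let Q : Fin (2 * d + 1) → Fin n := fun i => ⟨(i + l) % n, Nat.mod_lt _ hn⟩
  have hcard : min n (2 * d + 1) ≤ (Finset.univ.filter fun v => v ∈ range P ∪ range Q).card := by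
    have hsub : Finset.univ.image (Fin.castLE (min_le_left n (2 * d + 1))) ⊆
        Finset.univ.filter fun v => v ∈ range P ∪ range Q := by
      intro v hv
      obtain ⟨i, -, rfl⟩ := Finset.mem_image.1 hv
      refine Finset.mem_filter.2 ⟨Finset.mem_univ _, Or.inl ⟨Fin.castLE (min_le_right _ _) i, ?_⟩⟩
      exact Fin.ext (Nat.mod_eq_of_lt (i.2.trans_le (min_le_left _ _)))
    have := Finset.card_le_card hsub
    rwa [Finset.card_image_of_injective _ (Fin.castLE_injective _), Finset.card_univ,
      Fintype.card_fin] at this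
  obtain ⟨g, hg, hgz⟩ := exists_dist_lt_forall_exists_ne (κ := Unit) (W := Fin n)
    (A := fun _ => A) (D := fun _ => k) (comp := fun _ => ()) (e := fun i => T^[i])
    (fun _ => hAc) (fun _ => hkA A hAY hAc) (fun i => hT.iterate i) (fun i => hTinj.iterate i)
    (by
      intro v w hvw z hz z' hz' heq
      have hne : T^[v] x ≠ T^[w] x := fun h => hvw (Fin.ext (hxinj v v.2 w w.2 h))
      have hv : (v : ℕ) ≤ 4 * d := by omega
      have hw : (w : ℕ) ≤ 4 * d := by omega
      refine (disjoint_left.1 (hUdisj ⟨v, hv, rfl⟩ ⟨w, hw, rfl⟩ hne)) (hAU v hv z hz) ?_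
      rw [heq]
      exact hAU w hw z' hz')
    P Q
    (by
      intro i hi
      have hi' : (i : ℕ) % n = (i + l) % n := congrArg Fin.val hi
      refine hxl (hTinj.iterate i ?_)
      rw [← iterate_add_apply, hxY _ (by omega), ← hi', ← hxY _ (by omega)])
    (Finset.univ.filter fun v => v ∈ range P ∪ range Q) (by simp)
    (by simpa using hk.trans_le hcard) f hε
  refine ⟨g, hg, fun y hy => ?_⟩
  obtain ⟨i, hi⟩ := hgz fun _ => ⟨y, hy⟩
  refine ⟨i, by omega, ?_⟩
  rw [← iterate_add_apply, id, hAY hy _ (by omega), hAY hy (i + l) (by omega)]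
  exact hi

theorem residual_separating_distinct_orbits (hT : Continuous T) (hTinj : Injective T)
    (hdim : CovDimLE X d)
    (hper : ∀ n : ℕ, 1 ≤ n → n ≤ 2 * d →
      ∃ k : ℕ, 2 * k < n ∧ CovDimLE {x : X | ∃ j : ℕ, 1 ≤ j ∧ j ≤ n ∧ T^[j] x = x} k)
    {n m : ℕ} (hn : 1 ≤ n) (hm : 1 ≤ m) :
    {f : C(X, ℝ) | ∀ p ∈ {p : X × X | p.1 ∈ exactIterateModSet T (4 * d) n ∧
        p.2 ∈ exactIterateModSet T (4 * d) m ∧ ∀ i ≤ 2 * d, ∀ j ≤ 2 * d, T^[i] p.1 ≠ T^[j] p.2},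
      ∃ i : ℕ, i ≤ 2 * d ∧ f (T^[i] p.1) ≠ f (T^[i] p.2)} ∈ residual C(X, ℝ) := by
  classical
  refine residual_setOf_forall_of_nhdsWithin fun p hp => ?_
  obtain ⟨⟨-, hxinj⟩, ⟨-, hyinj⟩, hne⟩ := hp
  obtain ⟨U, hU, hUdisj⟩ := (((finite_Iic (2 * d)).image fun i => T^[i] p.1).union
    ((finite_Iic (2 * d)).image fun i => T^[i] p.2)).t2_separation
  obtain ⟨A, hAc, hAY, hAn, hAU⟩ := exists_isClosed_mem_nhdsWithin_iterateModSet hT _ n _ hU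
  obtain ⟨B, hBc, hBY, hBn, hBU⟩ := exists_isClosed_mem_nhdsWithin_iterateModSet hT _ m _ hU
  refine ⟨A ×ˢ B, nhdsWithin_mono p
    (t := iterateModSet T (4 * d) n ×ˢ iterateModSet T (4 * d) m)
    (fun z hz => ⟨hz.1.1, hz.2.1.1⟩) ?_, ?_⟩
  · rw [nhdsWithin_prod_eq]
    exact Filter.prod_mem_prod hAn hBn
  obtain ⟨k, hk, hkA⟩ := exists_covDimLE_of_subset_iterateModSet hdim hper hn
  obtain ⟨k', hk', hkB⟩ := exists_covDimLE_of_subset_iterateModSet hdim hper hm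
  refine residual_setOf_forall_exists_iterate_ne hT continuous_fst continuous_snd
    (hAc.isCompact.prod hBc.isCompact) fun f ε hε => ?_
  have hmod : ∀ (r : ℕ), 1 ≤ r → ∀ i : Fin (2 * d + 1), (i : ℕ) % r < min r (2 * d + 1) :=
    fun r hr i => lt_min (Nat.mod_lt _ hr) ((Nat.mod_le _ _).trans_lt i.2)
  let P : Fin (2 * d + 1) → Fin (min n (2 * d + 1)) ⊕ Fin (min m (2 * d + 1)) :=
    fun i => Sum.inl ⟨i % n, hmod n hn i⟩
  let Q : Fin (2 * d + 1) → Fin (min n (2 * d + 1)) ⊕ Fin (min m (2 * d + 1)) :=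
    fun i => Sum.inr ⟨i % m, hmod m hm i⟩
  obtain ⟨g, hg, hgz⟩ := exists_dist_lt_forall_exists_ne (κ := Bool)
    (W := Fin (min n (2 * d + 1)) ⊕ Fin (min m (2 * d + 1)))
    (A := fun b => cond b A B) (D := fun b => cond b k k')
    (comp := Sum.elim (fun _ => true) (fun _ => false))
    (e := fun v => T^[Sum.elim Fin.val Fin.val v])
    (by rintro (_ | _) <;> assumption)
    (by
      rintro (_ | _)
      · exact hkB B hBY hBc
      · exact hkA A hAY hAc)
    (fun i => hT.iterate _) (fun i => hTinj.iterate _)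
    (by
      have key : ∀ v : Fin (min n (2 * d + 1)) ⊕ Fin (min m (2 * d + 1)),
          T^[Sum.elim Fin.val Fin.val v] (Sum.elim (fun _ => p.1) (fun _ => p.2) v) ∈
            ((fun i => T^[i] p.1) '' Iic (2 * d)) ∪ ((fun i => T^[i] p.2) '' Iic (2 * d)) ∧
          ∀ z ∈ cond (Sum.elim (fun _ => true) (fun _ => false) v) A B,
            T^[Sum.elim Fin.val Fin.val v] z ∈ U (T^[Sum.elim Fin.val Fin.val v]
              (Sum.elim (fun _ => p.1) (fun _ => p.2) v)) := by
        rintro (⟨i, hi⟩ | ⟨i, hi⟩)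
        · have : i ≤ 2 * d := by omega
          exact ⟨Or.inl ⟨i, this, rfl⟩, hAU i (by omega)⟩
        · have : i ≤ 2 * d := by omega
          exact ⟨Or.inr ⟨i, this, rfl⟩, hBU i (by omega)⟩
      intro v w hvw z hz z' hz' heq
      refine disjoint_left.1 (hUdisj (key v).1 (key w).1 fun h => hvw ?_) ((key v).2 z hz)
        (heq ▸ (key w).2 z' hz')
      rcases v with ⟨i, hi⟩ | ⟨i, hi⟩ <;> rcases w with ⟨j, hj⟩ | ⟨j, hj⟩
      · obtain rfl := hxinj i (by omega) j (by omega) h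
        rfl
      · exact absurd h (hne i (by omega) j (by omega))
      · exact absurd h.symm (hne j (by omega) i (by omega))
      · obtain rfl := hyinj i (by omega) j (by omega) h
        rfl)
    P Q (fun i => Sum.inl_ne_inr) Finset.univ
    (by
      rintro (i | i)
      · refine ⟨fun _ => Or.inl ⟨Fin.castLE (min_le_right _ _) i, ?_⟩, fun _ => Finset.mem_univ _⟩
        exact congrArg Sum.inl (Fin.ext (Nat.mod_eq_of_lt (i.2.trans_le (min_le_left _ _))))
      · refine ⟨fun _ => Or.inr ⟨Fin.castLE (min_le_right _ _) i, ?_⟩, fun _ => Finset.mem_univ _⟩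
        exact congrArg Sum.inr (Fin.ext (Nat.mod_eq_of_lt (i.2.trans_le (min_le_left _ _)))))
    (by
      rw [Finset.card_univ, Fintype.card_sum, Fintype.card_fin, Fintype.card_fin,
        Fintype.sum_bool]
      simp only [cond_true, cond_false]
      omega) f hε
  refine ⟨g, hg, fun y hy => ?_⟩
  obtain ⟨i, hi⟩ := hgz fun b => match b with
    | true => ⟨y.1, hy.1⟩
    | false => ⟨y.2, hy.2⟩
  refine ⟨i, by omega, ?_⟩
  rw [hAY hy.1 _ (by omega), hBY hy.2 i (by omega)]
  exact hi

end Orbits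

/-- Gutman's theorem: for an injective continuous map `T` of a compact metric space `X` with
`dim X ≤ d` and `dim perₙ(T) < n/2` for `n = 1, …, 2d`, a residual set of `f ∈ C(X, ℝ)`
observes `T` in `2d` steps. -/
theorem stmt1 {X : Type*} [MetricSpace X] [CompactSpace X] (d : ℕ)
    (T : X → X) (hTcont : Continuous T)
    (hTinj : Function.Injective T)
    (hdim : CovDimLE X d)
    (hper : ∀ n : ℕ, 1 ≤ n → n ≤ 2 * d →
      ∃ k : ℕ, 2 * k < n ∧
        CovDimLE {x : X | ∃ j : ℕ, 1 ≤ j ∧ j ≤ n ∧ T^[j] x = x} k) :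
    {f : C(X, ℝ) | ∀ x y : X, x ≠ y →
        ∃ i : ℕ, i ≤ 2 * d ∧ f (T^[i] x) ≠ f (T^[i] y)} ∈ residual C(X, ℝ) := by
  have h1 := (countable_bInter_mem (l := residual C(X, ℝ))
    ((finite_Icc 1 (4 * d + 1)).prod (finite_Iic (2 * d))).countable).2
    fun q hq => residual_separating_same_orbit hTcont hTinj hdim hper hq.1.1 hq.1.2 hq.2
  have h2 := (countable_bInter_mem (l := residual C(X, ℝ))
    ((finite_Icc 1 (4 * d + 1)).prod (finite_Icc 1 (4 * d + 1))).countable).2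
    fun q hq => residual_separating_distinct_orbits hTcont hTinj hdim hper hq.1.1 hq.2.1
  refine Filter.mem_of_superset (Filter.inter_mem h1 h2) fun f hf => ?_
  have hsame : ∀ x l, l ≤ 2 * d → T^[l] x ≠ x →
      ∃ i : ℕ, i ≤ 2 * d ∧ f (T^[i] x) ≠ f (T^[i] (T^[l] x)) := by
    intro x l hl hne
    obtain ⟨n, hn, hn', hxn⟩ := exists_mem_exactIterateModSet hTinj (4 * d) x
    exact mem_iInter₂.1 hf.1 (n, l) ⟨⟨hn, hn'⟩, hl⟩ x ⟨hxn, hne⟩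
  have hback : ∀ x y i j, i ≤ j → T^[i] x = T^[j] y → x = T^[j - i] y := by
    intro x y i j hij h
    refine hTinj.iterate i ?_
    rw [← iterate_add_apply, Nat.add_sub_cancel' hij, h]
  intro x y hxy
  by_cases hrel : ∀ i ≤ 2 * d, ∀ j ≤ 2 * d, T^[i] x ≠ T^[j] y
  · obtain ⟨n, hn, hn', hxn⟩ := exists_mem_exactIterateModSet hTinj (4 * d) x
    obtain ⟨m, hm, hm', hym⟩ := exists_mem_exactIterateModSet hTinj (4 * d) y
    exact mem_iInter₂.1 hf.2 (n, m) ⟨⟨hn, hn'⟩, hm, hm'⟩ (x, y) ⟨hxn, hym, hrel⟩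
  · push Not at hrel
    obtain ⟨i, hi, j, hj, hij⟩ := hrel
    rcases le_total i j with hle | hle
    · obtain rfl := hback x y i j hle hij
      obtain ⟨t, ht, hne⟩ := hsame y (j - i) (by omega) hxy
      exact ⟨t, ht, hne.symm⟩
    · obtain rfl := hback y x j i hle hij.symm
      exact hsame x (i - j) (by omega) hxy.symm
end

section
/- Let X be a compact d-dimensional topological manifold with d ≥ 1 and let T : X → X be a continuous map that is locally injective but not injective. Then there exists a nonempty open set U ⊆ C(X, ℝ^d) such that no f ∈ U observes T. -/
open Set Topology Function

section Lipschitz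

variable {E F : Type*} [NormedAddCommGroup E] [NormedSpace ℝ E] [NormedAddCommGroup F]

lemma lipschitzWith_indicator_closedBall {g : E → F} {K : NNReal} {r : ℝ}
    (hg : LipschitzOnWith K g (Metric.closedBall 0 r)) (h0 : ∀ x ∈ Metric.sphere 0 r, g x = 0) :
    LipschitzWith K ((Metric.closedBall (0 : E) r).indicator g) := by
  classical
  have key : ∀ x ∈ Metric.closedBall (0 : E) r, ∀ y ∉ Metric.closedBall (0 : E) r,
      ‖g x‖ ≤ K * dist x y := by
    intro x hx y hy
    have hx' : ‖x‖ ≤ r := by simpa using hx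
    have hy' : r < ‖y‖ := by simpa using hy
    obtain ⟨t, ht, hz⟩ : ∃ t ∈ Icc (0 : ℝ) 1, ‖AffineMap.lineMap x y t‖ = r := by
      have hc : ContinuousOn (fun t : ℝ => ‖AffineMap.lineMap (k := ℝ) x y t‖) (Icc 0 1) := by
        have : Continuous (AffineMap.lineMap (k := ℝ) x y) := AffineMap.lineMap_continuous
        fun_prop
      have := intermediate_value_Icc zero_le_one hc
      exact this ⟨by simpa using hx', by simpa using hy'.le⟩
    set z := AffineMap.lineMap (k := ℝ) x y t
    have hgz : g z = 0 := h0 z (by simpa using hz)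
    calc ‖g x‖ = dist (g x) (g z) := by rw [hgz, dist_zero_right]
      _ ≤ K * dist x z := hg.dist_le_mul x hx z (by simpa using hz.le)
      _ ≤ K * dist x y := by
        gcongr
        rw [dist_left_lineMap]
        calc ‖t‖ * dist x y ≤ 1 * dist x y := by
              gcongr
              rw [Real.norm_eq_abs, abs_of_nonneg ht.1]; exact ht.2
          _ = dist x y := one_mul _
  refine LipschitzWith.of_dist_le_mul fun x y => ?_
  by_cases hx : x ∈ Metric.closedBall (0 : E) r <;> by_cases hy : y ∈ Metric.closedBall (0 : E) r
  · simpa [indicator_of_mem hx, indicator_of_mem hy] using hg.dist_le_mul x hx y hy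
  · simpa [indicator_of_mem hx, indicator_of_notMem hy] using key x hx y hy
  · simpa [indicator_of_notMem hx, indicator_of_mem hy, dist_comm] using key y hy x hx
  · simp only [indicator_of_notMem hx, indicator_of_notMem hy, dist_self]
    positivity

end Lipschitz

lemma bijective_add_of_lipschitzWith {E : Type*} [NormedAddCommGroup E] [CompleteSpace E]
    {g : E → E} {K : NNReal} (hK : K < 1) (hg : LipschitzWith K g) : Bijective fun x => x + g x := by
  constructor
  · intro x y hxy
    have h1 : x - y = g y - g x := by
      have : x + g x = y + g y := hxy
      rw [sub_eq_sub_iff_add_eq_add, this, add_comm]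
    have h2 := hg.dist_le_mul y x
    rw [dist_eq_norm, ← h1, dist_comm, dist_eq_norm] at h2
    have hK' : (K : ℝ) < 1 := by exact_mod_cast hK
    have : ‖x - y‖ = 0 := by nlinarith [norm_nonneg (x - y)]
    exact sub_eq_zero.1 (norm_eq_zero.1 this)
  · intro y
    have hc : ContractingWith K fun x => y - g x := by
      refine ⟨hK, LipschitzWith.of_dist_le_mul fun a b => ?_⟩
      rw [dist_sub_left]
      exact hg.dist_le_mul a b
    refine ⟨hc.fixedPoint, ?_⟩
    have := hc.fixedPoint_isFixedPt
    exact (eq_sub_iff_add_eq.1 this.eq.symm)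

section Det

variable {E : Type*} [NormedAddCommGroup E] [NormedSpace ℝ E] [FiniteDimensional ℝ E]

lemma exists_det_one_add_eq_sum {v : ℕ → ℝ} (hv : Injective v) :
    ∃ c : ℕ → ℝ, ∑ i ∈ Finset.range (Module.finrank ℝ E + 1), c i = 1 ∧
      ∀ A : E →L[ℝ] E, (1 + A).det =
        ∑ i ∈ Finset.range (Module.finrank ℝ E + 1), c i * (1 + v i • A).det := by
  classical
  set s := Finset.range (Module.finrank ℝ E + 1)
  refine ⟨fun i => (Lagrange.basis s v i).eval 1, ?_, fun A => ?_⟩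
  · rw [← Polynomial.eval_finsetSum, Lagrange.sum_basis hv.injOn ⟨0, by simp [s]⟩]
    simp
  · let b := Module.finBasis ℝ E
    let M := LinearMap.toMatrix b b (A : E →ₗ[ℝ] E)
    let P : Polynomial ℝ := ((Polynomial.X : Polynomial ℝ) • M.map Polynomial.C +
      (1 : Matrix _ _ ℝ).map Polynomial.C).det
    have hP : ∀ t : ℝ, P.eval t = (1 + t • A).det := by
      intro t
      rw [ContinuousLinearMap.det, ← LinearMap.det_toMatrix b]
      rw [← Polynomial.coe_evalRingHom, RingHom.map_det]
      congr 1
      ext i j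
      simp [M, add_comm, LinearMap.toMatrix_apply, Matrix.one_apply, Finsupp.single_apply, eq_comm,
        apply_ite]
      exact mul_comm _ _
    have hdeg : P.degree < s.card := by
      refine lt_of_le_of_lt Polynomial.degree_le_natDegree ?_
      have : P.natDegree ≤ Fintype.card (Fin (Module.finrank ℝ E)) :=
        Polynomial.natDegree_det_X_add_C_le M 1
      simp only [Fintype.card_fin] at this
      rw [Finset.card_range]
      exact_mod_cast Nat.lt_succ_of_le this
    have := congrArg (Polynomial.eval 1) (Lagrange.eq_interpolate hv.injOn hdeg)
    rw [hP, Lagrange.interpolate_apply, Polynomial.eval_finsetSum, one_smul] at this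
    rw [this]
    refine Finset.sum_congr rfl fun i _ => ?_
    simp [hP, mul_comm]

end Det

section NoRetraction

open MeasureTheory Metric

variable {E : Type*} [NormedAddCommGroup E] [NormedSpace ℝ E] [FiniteDimensional ℝ E]

lemma injOn_and_image_closedBall_add {g : E → E} {K : NNReal} {r : ℝ} (hK : K < 1)
    (hg : LipschitzOnWith K g (closedBall 0 r)) (h0 : ∀ x ∈ sphere 0 r, g x = 0) :
    InjOn (fun x => x + g x) (closedBall 0 r) ∧
      (fun x => x + g x) '' closedBall 0 r = closedBall 0 r := by
  have hbij := bijective_add_of_lipschitzWith hK (lipschitzWith_indicator_closedBall hg h0)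
  set B := closedBall (0 : E) r
  set φ : E → E := fun x => x + B.indicator g x with hφ
  have hin : EqOn (fun x => x + g x) φ B := fun x hx => by simp [hφ, indicator_of_mem hx]
  have hout : ∀ x ∉ B, φ x = x := fun x hx => by simp [hφ, indicator_of_notMem hx]
  refine ⟨hbij.1.injOn.congr hin.symm, ?_⟩
  rw [hin.image_eq]
  have hc : φ '' Bᶜ = Bᶜ := by
    exact (image_congr (g := id) fun x hx => hout x hx).trans (image_id _)
  rw [← compl_inj_iff, ← image_compl_eq hbij, hc]

variable [MeasurableSpace E] [BorelSpace E] (μ : Measure E) [μ.IsAddHaarMeasure]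

lemma integral_det_one_add_fderiv {g : E → E} {r : ℝ} (hg : ContDiff ℝ 1 g)
    (h0 : ∀ x ∈ sphere 0 r, g x = 0) :
    ∫ x in closedBall 0 r, (1 + fderiv ℝ g x).det ∂μ = μ.real (closedBall 0 r) := by
  have hcont : Continuous (fderiv ℝ g) := hg.continuous_fderiv one_ne_zero
  have hdiff : Differentiable ℝ g := hg.differentiable one_ne_zero
  have hcomp : IsCompact (closedBall (0 : E) r) := isCompact_closedBall 0 r
  obtain ⟨C, hC⟩ := hcomp.exists_bound_of_continuousOn hcont.continuousOn
  obtain ⟨ε, hε, hdet⟩ : ∃ ε > 0, ∀ A : E →L[ℝ] E, ‖A‖ < ε → 0 < (1 + A).det := by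
    have hc : ContinuousAt (fun A : E →L[ℝ] E => (1 + A).det) 0 :=
      (ContinuousLinearMap.continuous_det.comp (by fun_prop)).continuousAt
    have h1 : ∀ᶠ A in 𝓝 (0 : E →L[ℝ] E), 0 < (1 + A).det := by
      refine hc.eventually_const_lt ?_
      simp [ContinuousLinearMap.det]
    obtain ⟨ε, hε, h⟩ := Metric.eventually_nhds_iff.1 h1
    exact ⟨ε, hε, fun A hA => h (by simpa using hA)⟩
  have hsmall : ∀ t : ℝ, 0 < t → t * |C| < 1 → t * |C| < ε →
      ∫ x in closedBall 0 r, (1 + t • fderiv ℝ g x).det ∂μ = μ.real (closedBall 0 r) := by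
    intro t ht h1 h2
    have hnorm : ∀ x ∈ closedBall (0 : E) r, ‖t • fderiv ℝ g x‖ ≤ t * |C| := by
      intro x hx
      rw [norm_smul, Real.norm_eq_abs, abs_of_pos ht]
      gcongr
      exact (hC x hx).trans (le_abs_self C)
    have hd : ∀ x, HasFDerivAt (fun x => t • g x) (t • fderiv ℝ g x) x := fun x =>
      (hdiff x).hasFDerivAt.const_smul t
    have hlip : LipschitzOnWith ⟨t * |C|, by positivity⟩ (fun x => t • g x)
        (closedBall 0 r) :=
      (convex_closedBall 0 r).lipschitzOnWith_of_nnnorm_hasFDerivWithin_le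
        (fun x _ => (hd x).hasFDerivWithinAt) (fun x hx => hnorm x hx)
    obtain ⟨hinj, himg⟩ := injOn_and_image_closedBall_add (K := ⟨t * |C|, by positivity⟩) h1 hlip
      (fun x hx => by simp [h0 x hx])
    have hcv := integral_image_eq_integral_abs_det_fderiv_smul μ hcomp.measurableSet
      (f := fun x => x + t • g x) (f' := fun x => 1 + t • fderiv ℝ g x)
      (fun x _ => ((hasFDerivAt_id x).add (hd x)).hasFDerivWithinAt) hinj (fun _ => (1 : ℝ))
    rw [himg] at hcv
    simp only [integral_const, smul_eq_mul, mul_one, measureReal_restrict_apply_univ] at hcv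
    rw [hcv]
    refine setIntegral_congr_fun hcomp.measurableSet fun x hx => ?_
    exact (abs_of_pos (hdet _ ((hnorm x hx).trans_lt h2))).symm
  obtain ⟨τ, hτ, hτ1, hτ2⟩ : ∃ τ : ℝ, 0 < τ ∧ τ * |C| < 1 ∧ τ * |C| < ε := by
    refine ⟨min 1 ε / (|C| + 1), by positivity, ?_, ?_⟩
    · rw [div_mul_eq_mul_div, div_lt_iff₀ (by positivity)]
      nlinarith [min_le_left 1 ε, abs_nonneg C]
    · rw [div_mul_eq_mul_div, div_lt_iff₀ (by positivity)]
      nlinarith [min_le_right 1 ε, abs_nonneg C]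
  have hv : Injective fun i : ℕ => τ / (i + 1) := by
    intro i j hij
    have hij' : τ / ((i : ℝ) + 1) = τ / (j + 1) := hij
    have : (i : ℝ) + 1 = j + 1 := by
      field_simp at hij'
      linarith
    exact_mod_cast add_right_cancel this
  obtain ⟨c, hc1, hc⟩ := exists_det_one_add_eq_sum (E := E) hv
  rw [integral_congr_ae (.of_forall fun x => hc _), integral_finsetSum]
  · have : ∀ i : ℕ, τ / ((i : ℝ) + 1) ≤ τ := fun i => div_le_self hτ.le (by simp)
    simp_rw [integral_const_mul]
    rw [Finset.sum_congr rfl fun i _ => ?_, ← Finset.sum_mul, hc1, one_mul]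
    congr 1
    refine hsmall _ (by positivity) (lt_of_le_of_lt ?_ hτ1) (lt_of_le_of_lt ?_ hτ2) <;>
    · gcongr
      exact this i
  · intro i _
    refine ContinuousOn.integrableOn_compact hcomp (Continuous.continuousOn ?_)
    exact continuous_const.mul (ContinuousLinearMap.continuous_det.comp (by fun_prop))

end NoRetraction

section StableZero

open MeasureTheory Metric

variable {E : Type*} [NormedAddCommGroup E] [InnerProductSpace ℝ E] [FiniteDimensional ℝ E]

lemma det_fderiv_eq_zero_of_norm_eq_one {ρ : E → E} {x : E}
    (hρ : DifferentiableAt ℝ ρ x) (h1 : ∀ y, ‖ρ y‖ = 1) : (fderiv ℝ ρ x).det = 0 := by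
  by_contra hne
  obtain ⟨v, hv⟩ := ((fderiv ℝ ρ x : E →ₗ[ℝ] E).equivOfDetNeZero hne).surjective (ρ x)
  have hd : HasFDerivAt (fun y => inner ℝ (ρ y) (ρ y))
      _ x := hρ.hasFDerivAt.inner ℝ hρ.hasFDerivAt
  have hc : (fun y => inner ℝ (ρ y) (ρ y)) = fun _ => (1 : ℝ) := by
    ext y
    rw [real_inner_self_eq_norm_sq, h1, one_pow]
  rw [hc] at hd
  have := congrArg (fun L => L v) (hd.unique (hasFDerivAt_const 1 x))
  have hv' : fderiv ℝ ρ x v = ρ x := hv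
  simp [hv', h1] at this

lemma exists_eq_zero_of_contDiff_of_eq_self {F : E → E} (hF : ContDiff ℝ 1 F)
    (hid : ∀ x ∈ sphere 0 1, F x = x) : ∃ x, F x = 0 := by
  by_contra! hne
  borelize E
  set ρ : E → E := fun x => ‖F x‖⁻¹ • F x with hρdef
  have hρ : ContDiff ℝ 1 ρ := ((hF.norm ℝ hne).inv fun x => norm_ne_zero_iff.2 (hne x)).smul hF
  have h1 : ∀ x, ‖ρ x‖ = 1 := fun x => norm_smul_inv_norm (hne x)
  have h := integral_det_one_add_fderiv (Measure.addHaar (G := E)) (r := 1)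
    (g := fun x => ρ x - x) (hρ.sub contDiff_id) fun x hx => by
      have hx' : ‖x‖ = 1 := by simpa using hx
      simp [hρdef, hid x hx, hx']
  have hz : ∀ x, (1 + fderiv ℝ (fun x => ρ x - x) x).det = 0 := by
    intro x
    have hdx := hρ.differentiable one_ne_zero x
    rw [fderiv_fun_sub hdx differentiableAt_fun_id]
    rw [fderiv_fun_id, ← det_fderiv_eq_zero_of_norm_eq_one hdx h1]
    congr 1
    ext; simp
  simp only [hz, integral_zero] at h
  have : 0 < (Measure.addHaar (G := E)).real (closedBall 0 1) :=
    ENNReal.toReal_pos (measure_closedBall_pos _ _ one_pos).ne' measure_closedBall_lt_top.ne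
  exact this.ne h

lemma ContinuousOn.exists_continuous_eqOn {X : Type*} [TopologicalSpace X] [NormalSpace X]
    {s : Set X} {f : X → E} (hf : ContinuousOn f s) (hs : IsClosed s) : ∃ g : C(X, E), EqOn g f s := by
  have := TietzeExtension.of_tvs ℝ (E := E)
  obtain ⟨g, hg⟩ := ContinuousMap.exists_restrict_eq hs ⟨s.domRestrict f, hf.domRestrict⟩
  exact ⟨g, fun x hx => DFunLike.congr_fun hg ⟨x, hx⟩⟩

/-- A continuous map that moves points of the unit ball by at most `1 / 2` has a zero there. -/
lemma exists_eq_zero_of_dist_le_half {h : E → E}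
    (hc : ContinuousOn h (closedBall 0 1)) (hd : ∀ x ∈ closedBall 0 1, ‖h x - x‖ ≤ 1 / 2) :
    ∃ x ∈ closedBall 0 1, h x = 0 := by
  by_contra! hne
  have hcomp : IsCompact (closedBall (0 : E) 1) := isCompact_closedBall 0 1
  obtain ⟨x₀, hx₀, hmin⟩ := hcomp.exists_isMinOn ⟨0, by simp⟩ hc.norm
  have hδ : 0 < ‖h x₀‖ := norm_pos_iff.2 (hne x₀ hx₀)
  set δ := ‖h x₀‖
  obtain ⟨u, hu⟩ := ContinuousOn.exists_continuous_eqOn (hc.sub continuousOn_id)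
    isClosed_closedBall
  obtain ⟨w, hw, hwu, -⟩ := u.continuous.exists_contDiff_approx 1
    (ε := fun _ => min δ (1 / 4)) continuous_const fun _ => by positivity
  let χ : ContDiffBump (0 : E) := ⟨4 / 5, 1, by norm_num, by norm_num⟩
  obtain ⟨x, hx⟩ := exists_eq_zero_of_contDiff_of_eq_self (F := fun x => x + χ x • w x)
    (contDiff_id.add (χ.contDiff.smul hw)) fun x hx => by
      rw [χ.zero_of_le_dist (by simpa using (mem_sphere.1 hx).ge)]; simp
  by_cases hx1 : x ∈ closedBall (0 : E) 1
  · have h1 := hwu x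
    rw [dist_eq_norm, lt_min_iff, hu hx1] at h1
    have h2 : δ ≤ ‖h x‖ := hmin hx1
    by_cases hx2 : x ∈ closedBall (0 : E) (4 / 5)
    · rw [χ.one_of_mem_closedBall hx2, one_smul] at hx
      have : w x - (h x - x) = - h x := by rw [eq_neg_of_add_eq_zero_right hx]; abel
      simp only [Pi.sub_apply, id, this, norm_neg] at h1
      linarith
    · have hx2' : 4 / 5 < ‖x‖ := by simpa using hx2
      have h3 : ‖x‖ = ‖χ x • w x‖ := by rw [eq_neg_of_add_eq_zero_right hx, norm_neg]
      have h4 : ‖χ x • w x‖ ≤ ‖w x‖ := by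
        rw [norm_smul, Real.norm_eq_abs, abs_of_nonneg χ.nonneg]
        exact mul_le_of_le_one_left (norm_nonneg _) χ.le_one
      have h5 : ‖w x‖ ≤ ‖w x - (h x - x)‖ + ‖h x - x‖ := by
        simpa using norm_add_le (w x - (h x - x)) (h x - x)
      have h6 := h1.2
      simp only [Pi.sub_apply, id] at h6
      linarith [hd x hx1]
  · have hx1' : 1 < ‖x‖ := by simpa using hx1
    rw [χ.zero_of_le_dist (by simpa using hx1'.le)] at hx
    have : x = 0 := by simpa using hx
    rw [this] at hx1'
    simp at hx1'
    linarith

end StableZero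

section InvarianceOfDomain

open MeasureTheory Metric

lemma IsCompact.exists_continuousOn_leftInvOn {X Y : Type*} [TopologicalSpace X]
    [Nonempty X] [TopologicalSpace Y] [T2Space Y] {K : Set X} {f : X → Y} (hK : IsCompact K)
    (hf : ContinuousOn f K) (hinj : InjOn f K) :
    ∃ g : Y → X, ContinuousOn g (f '' K) ∧ LeftInvOn g f K := by
  refine ⟨invFunOn f K, continuousOn_iff_isClosed.2 fun t ht => ⟨f '' (K ∩ t),
    ((hK.inter_right ht).image_of_continuousOn (hf.mono inter_subset_left)).isClosed, ?_⟩,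
    hinj.leftInvOn_invFunOn⟩
  ext y
  constructor
  · rintro ⟨hy, x, hx, rfl⟩
    rw [mem_preimage, hinj.leftInvOn_invFunOn hx] at hy
    exact ⟨mem_image_of_mem f ⟨hx, hy⟩, mem_image_of_mem f hx⟩
  · rintro ⟨⟨x, ⟨hx, hxt⟩, rfl⟩, hy⟩
    exact ⟨by rwa [mem_preimage, hinj.leftInvOn_invFunOn hx], hy⟩

variable {E : Type*} [NormedAddCommGroup E] [InnerProductSpace ℝ E] [FiniteDimensional ℝ E]
  [Nontrivial E]

lemma image_closedBall_mem_nhds_of_injOn {f : E → E} (hc : ContinuousOn f (closedBall 0 1))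
    (hinj : InjOn f (closedBall 0 1)) : f '' closedBall 0 1 ∈ 𝓝 (f 0) := by
  by_contra hnot
  borelize E
  have hcomp : IsCompact (closedBall (0 : E) 1) := isCompact_closedBall 0 1
  have h0 : (0 : E) ∈ closedBall (0 : E) 1 := by simp
  have hK := hcomp.image_of_continuousOn hc
  obtain ⟨g, hg, hgf⟩ := hcomp.exists_continuousOn_leftInvOn hc hinj
  obtain ⟨G, hG⟩ := hg.exists_continuous_eqOn hK.isClosed
  have hGf : ∀ x ∈ closedBall (0 : E) 1, G (f x) = x := fun x hx => by
    rw [hG (mem_image_of_mem f hx), hgf hx]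
  obtain ⟨η, hη, hGη⟩ := Metric.continuous_iff.1 G.continuous (f 0) (1 / 10) (by norm_num)
  simp only [hGf 0 h0, dist_zero_right] at hGη
  obtain ⟨ε, hε, rfl⟩ : ∃ ε > 0, 2 * ε = η := ⟨η / 2, by positivity, by ring⟩
  obtain ⟨c, hcε, hcK⟩ : ∃ c, dist (f 0) c < ε ∧ c ∉ f '' closedBall 0 1 := by
    by_contra! h
    exact hnot (Filter.mem_of_superset (ball_mem_nhds _ hε) fun c hc => h c (mem_ball'.1 hc))
  obtain ⟨δ, hδ, hGδ⟩ : ∃ δ, 0 < δ ∧ ∀ y ∈ f '' closedBall 0 1 \ ball c ε, δ ≤ ‖G y‖ := by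
    refine (hK.diff isOpen_ball).exists_forall_le' (by fun_prop) ?_
    rintro _ ⟨⟨x, hx, rfl⟩, hxc⟩
    rw [norm_pos_iff, hGf x hx]
    rintro rfl
    exact hxc hcε
  set δ' := min δ (1 / 10)
  have hδ' : 0 < δ' := by positivity
  have hδ10 : δ' ≤ 1 / 10 := min_le_right _ _
  obtain ⟨P, hP, hPG, -⟩ := G.continuous.exists_contDiff_approx 1
    (ε := fun _ => δ' / 2) continuous_const fun _ => by positivity
  obtain ⟨v, hv, hvP⟩ : ∃ v, ‖v‖ < δ' / 2 ∧ v ∉ P '' sphere c ε := by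
    by_contra! h
    have hnull : Measure.addHaar (P '' sphere c ε) = 0 :=
      addHaar_image_eq_zero_of_differentiableOn_of_addHaar_eq_zero _
        (hP.differentiable one_ne_zero).differentiableOn (Measure.addHaar_sphere _ c ε)
    have hsub : ball (0 : E) (δ' / 2) ⊆ P '' sphere c ε := fun v hv => h v (by simpa using hv)
    exact (measure_ball_pos Measure.addHaar (0 : E) (by positivity : 0 < δ' / 2)).ne'
      (measure_mono_null hsub hnull)
  have hPv : ∀ y, ‖P y - v - G y‖ < δ' := fun y => by
    have h1 := hPG y
    rw [dist_eq_norm] at h1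
    calc ‖P y - v - G y‖ = ‖(P y - G y) - v‖ := by congr 1; abel
      _ ≤ ‖P y - G y‖ + ‖v‖ := norm_sub_le _ _
      _ < δ' := by linarith
  set Φ : E → E := fun y => c + max (ε / ‖y - c‖) 1 • (y - c) with hΦ
  have hne : ∀ x ∈ closedBall (0 : E) 1, ‖f x - c‖ ≠ 0 := fun x hx h =>
    hcK ⟨x, hx, sub_eq_zero.1 (norm_eq_zero.1 h)⟩
  have hΦfar : ∀ y, ε ≤ ‖y - c‖ → Φ y = y := fun y hy => by
    have : max (ε / ‖y - c‖) 1 = 1 := max_eq_right (div_le_one_of_le₀ hy (norm_nonneg _))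
    simp [hΦ, this]
  have hΦnear : ∀ y, ‖y - c‖ ≠ 0 → ‖y - c‖ < ε → Φ y ∈ sphere c ε := fun y hy0 hy => by
    have hpos : 0 < ‖y - c‖ := (norm_nonneg _).lt_of_ne' hy0
    have : max (ε / ‖y - c‖) 1 = ε / ‖y - c‖ := max_eq_left ((one_le_div hpos).2 hy.le)
    rw [mem_sphere, dist_eq_norm]
    simp only [hΦ, this, add_sub_cancel_left, norm_smul, norm_div, norm_norm]
    rw [div_mul_cancel₀ _ hy0, Real.norm_eq_abs, abs_of_pos hε]
  have hΦc : ContinuousOn (fun x => P (Φ (f x)) - v) (closedBall 0 1) := by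
    refine (hP.continuous.comp_continuousOn ?_).sub continuousOn_const
    refine continuousOn_const.add (ContinuousOn.smul (ContinuousOn.sup ?_ continuousOn_const)
      (hc.sub continuousOn_const))
    exact continuousOn_const.div (hc.sub continuousOn_const).norm hne
  obtain ⟨x, hx, hx0⟩ := exists_eq_zero_of_dist_le_half hΦc fun x hx => by
    rcases le_or_gt ε ‖f x - c‖ with hfar | hnear
    · rw [hΦfar _ hfar]
      have := hPv (f x)
      rw [hGf x hx] at this
      linarith
    · have hs := hΦnear _ (hne x hx) hnear
      have hd1 : dist (f x) (f 0) < 2 * ε := by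
        have := dist_triangle_right (f x) (f 0) c
        rw [dist_eq_norm (f x) c] at this
        linarith
      have hd2 : dist (Φ (f x)) (f 0) < 2 * ε := by
        have := dist_triangle_right (Φ (f x)) (f 0) c
        rw [mem_sphere.1 hs] at this
        linarith
      have h1 := hGη _ hd1
      rw [hGf x hx] at h1
      have h2 := hGη _ hd2
      have h3 := hPv (Φ (f x))
      have h4 := norm_add_le (P (Φ (f x)) - v - G (Φ (f x))) (G (Φ (f x)))
      rw [sub_add_cancel] at h4
      have h5 := norm_sub_le (P (Φ (f x)) - v) x
      linarith
  rcases le_or_gt ε ‖f x - c‖ with hfar | hnear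
  · rw [hΦfar _ hfar] at hx0
    have h1 := hPv (f x)
    rw [hx0, zero_sub, norm_neg] at h1
    have h2 := hGδ (f x) ⟨mem_image_of_mem f hx, by simpa [dist_eq_norm] using hfar⟩
    exact absurd (h1.trans_le (min_le_left _ _)) h2.not_gt
  · exact hvP ⟨Φ (f x), hΦnear _ (hne x hx) hnear, sub_eq_zero.1 hx0⟩

/-- **Invariance of domain**, in neighborhood form. -/
lemma image_mem_nhds_of_injOn {f : E → E} {s : Set E} {a : E} (hc : ContinuousOn f s)
    (hinj : InjOn f s) (hs : s ∈ 𝓝 a) : f '' s ∈ 𝓝 (f a) := by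
  obtain ⟨r, hr, hrs⟩ := nhds_basis_closedBall.mem_iff.1 hs
  have hmaps : MapsTo (fun z : E => a + r • z) (closedBall 0 1) s := fun z hz => hrs <| by
    have hz' : ‖z‖ ≤ 1 := by simpa using hz
    rw [mem_closedBall, dist_eq_norm, add_sub_cancel_left, norm_smul, Real.norm_eq_abs,
      abs_of_pos hr]
    exact mul_le_of_le_one_right hr.le hz'
  have h := image_closedBall_mem_nhds_of_injOn (f := fun z => f (a + r • z))
    (hc.comp (by fun_prop) hmaps) (hinj.comp (fun z _ w _ hzw => by
      simpa [hr.ne'] using hzw) hmaps)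
  simp only [smul_zero, add_zero] at h
  refine Filter.mem_of_superset h ?_
  rintro _ ⟨z, hz, rfl⟩
  exact mem_image_of_mem f (hmaps hz)

lemma ChartedSpace.image_mem_nhds_of_injOn {X Y : Type*} [TopologicalSpace X] [TopologicalSpace Y]
    [ChartedSpace E X] [ChartedSpace E Y] {T : X → Y} {U : Set X} {x : X} (hT : Continuous T)
    (hinj : InjOn T U) (hU : U ∈ 𝓝 x) : T '' U ∈ 𝓝 (T x) := by
  set φ := chartAt E x
  set ψ := chartAt E (T x)
  have hφx : x ∈ φ.source := mem_chart_source E x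
  have hψx : T x ∈ ψ.source := mem_chart_source E (T x)
  set N := φ.source ∩ (U ∩ T ⁻¹' ψ.source)
  have hN : N ∈ 𝓝 x := Filter.inter_mem (φ.open_source.mem_nhds hφx)
    (Filter.inter_mem hU (hT.continuousAt (ψ.open_source.mem_nhds hψx)))
  have hmaps : MapsTo φ.symm (φ '' N) N := by
    rintro _ ⟨z, hz, rfl⟩
    rwa [φ.left_inv hz.1]
  have hφN : φ '' N ⊆ φ.target := image_subset_iff.2 fun z hz => φ.map_source hz.1
  have h := _root_.image_mem_nhds_of_injOn (f := fun z => ψ (T (φ.symm z))) (s := φ '' N)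
    (a := φ x)
    (ψ.continuousOn.comp (hT.comp_continuousOn (φ.symm.continuousOn.mono hφN))
      fun z hz => (hmaps hz).2.2)
    ((ψ.injOn.comp (hinj.mono fun z hz => hz.2.1) fun z hz => hz.2.2).comp
      (φ.symm.injOn.mono hφN) hmaps)
    (φ.image_mem_nhds hφx hN)
  simp only [φ.left_inv hφx] at h
  have h' := ψ.symm.image_mem_nhds (ψ.map_source hψx) h
  rw [ψ.left_inv hψx] at h'
  refine Filter.mem_of_superset h' ?_
  rintro _ ⟨_, ⟨_, ⟨z, hz, rfl⟩, rfl⟩, rfl⟩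
  refine ⟨z, hz.2.1, ?_⟩
  simp only [φ.left_inv hz.1, ψ.left_inv hz.2.2]

end InvarianceOfDomain

/-- For a non-injective, locally injective continuous map `T` of a compact `d`-dimensional
topological manifold `X` (`d ≥ 1`), there is a nonempty open set `U ⊆ C(X, ℝ^d)` such that
no `f ∈ U` observes `T`. -/
theorem stmt2 {X : Type*} [MetricSpace X] [CompactSpace X]
    (d : ℕ) (hd : 1 ≤ d)
    [ChartedSpace (EuclideanSpace ℝ (Fin d)) X]
    (T : X → X) (hTcont : Continuous T)
    (hTloc : ∀ x : X, ∃ U ∈ 𝓝 x, Set.InjOn T U)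
    (hTnotinj : ¬ Function.Injective T) :
    ∃ U : Set C(X, EuclideanSpace ℝ (Fin d)), IsOpen U ∧ U.Nonempty ∧
      ∀ f ∈ U, ¬ (∀ x y : X, x ≠ y → ∃ n : ℕ, f (T^[n] x) ≠ f (T^[n] y)) := by
  have : Nonempty (Fin d) := ⟨⟨0, hd⟩⟩
  obtain ⟨x, y, hxy, hne⟩ : ∃ x y, T x = T y ∧ x ≠ y := by
    simpa [Injective] using hTnotinj
  have : Nonempty X := ⟨x⟩
  obtain ⟨A, B, hA, hB, hxA, hyB, hAB⟩ := t2_separation hne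
  obtain ⟨V₀, hV₀, hV₀inj⟩ := hTloc y
  obtain ⟨V, hV, hVclosed, hVsub⟩ :=
    exists_mem_nhds_isClosed_subset (Filter.inter_mem hV₀ (hB.mem_nhds hyB))
  have hVinj : InjOn T V := hV₀inj.mono fun z hz => (hVsub hz).1
  obtain ⟨S, hS, hST⟩ := hVclosed.isCompact.exists_continuousOn_leftInvOn hTcont.continuousOn hVinj
  have hTV : T '' V ∈ 𝓝 (T x) := hxy ▸ ChartedSpace.image_mem_nhds_of_injOn
    (E := EuclideanSpace ℝ (Fin d)) hTcont hVinj hV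
  set φ := chartAt (EuclideanSpace ℝ (Fin d)) x
  have hφx : x ∈ φ.source := mem_chart_source _ x
  have hN : φ.target ∩ φ.symm ⁻¹' (A ∩ T ⁻¹' (T '' V)) ∈ 𝓝 (φ x) := by
    refine Filter.inter_mem (φ.open_target.mem_nhds (φ.map_source hφx))
      ((φ.symm.continuousAt (φ.map_source hφx)) ?_)
    rw [φ.left_inv hφx]
    exact Filter.inter_mem (hA.mem_nhds hxA) (hTcont.continuousAt hTV)
  obtain ⟨r, hr, hrN⟩ := Metric.nhds_basis_closedBall.mem_iff.1 hN
  have hmaps : ∀ z ∈ Metric.closedBall (0 : EuclideanSpace ℝ (Fin d)) 1,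
      φ x + r • z ∈ Metric.closedBall (φ x) r := fun z hz => by
    have hz' : ‖z‖ ≤ 1 := by simpa using hz
    rw [mem_closedBall_iff_norm, add_sub_cancel_left, norm_smul, Real.norm_eq_abs, abs_of_pos hr]
    exact mul_le_of_le_one_right hr.le hz'
  set k : EuclideanSpace ℝ (Fin d) → X := fun z => φ.symm (φ x + r • z) with hk
  have hkA : ∀ z ∈ Metric.closedBall (0 : EuclideanSpace ℝ (Fin d)) 1, k z ∈ A :=
    fun z hz => (hrN (hmaps z hz)).2.1
  have hkT : ∀ z ∈ Metric.closedBall (0 : EuclideanSpace ℝ (Fin d)) 1, T (k z) ∈ T '' V :=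
    fun z hz => (hrN (hmaps z hz)).2.2
  have hkc : ContinuousOn k (Metric.closedBall 0 1) :=
    φ.symm.continuousOn.comp (by fun_prop) fun z hz => (hrN (hmaps z hz)).1
  have hkinj : InjOn k (Metric.closedBall 0 1) := fun z hz w hw h => by
    have := φ.symm.injOn (hrN (hmaps z hz)).1 (hrN (hmaps w hw)).1 h
    simpa [hr.ne'] using this
  have hcomp : IsCompact (Metric.closedBall (0 : EuclideanSpace ℝ (Fin d)) 1) :=
    isCompact_closedBall _ _
  have hW : IsClosed (k '' Metric.closedBall 0 1) := (hcomp.image_of_continuousOn hkc).isClosed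
  obtain ⟨g, hg, hgk⟩ := hcomp.exists_continuousOn_leftInvOn hkc hkinj
  obtain ⟨G, hG⟩ := hg.exists_continuous_eqOn hW
  have hVA : ∀ q ∈ V, q ∉ A := fun q hq hqA => disjoint_left.1 hAB hqA (hVsub hq).2
  obtain ⟨η, hη0, hη1, -⟩ := exists_continuous_zero_one_of_isClosed hVclosed hW <| by
    rw [disjoint_left]
    rintro _ hq ⟨z, hz, rfl⟩
    exact hVA _ hq (hkA z hz)
  set f₀ : C(X, EuclideanSpace ℝ (Fin d)) := ⟨fun p => η p • G p, by fun_prop⟩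
  have hf₀k : ∀ z ∈ Metric.closedBall (0 : EuclideanSpace ℝ (Fin d)) 1, f₀ (k z) = z := by
    intro z hz
    have hmem := mem_image_of_mem k hz
    simp [f₀, hη1 hmem, hG hmem, hgk hz]
  have hf₀V : ∀ q ∈ V, f₀ q = 0 := fun q hq => by simp [f₀, hη0 hq]
  refine ⟨Metric.ball f₀ (1 / 4), Metric.isOpen_ball, ⟨f₀, by simp⟩, fun f hf hobs => ?_⟩
  have hdist : ∀ p, ‖f p - f₀ p‖ ≤ 1 / 4 := fun p => by
    rw [← dist_eq_norm]
    exact (ContinuousMap.dist_apply_le_dist p).trans (Metric.mem_ball.1 hf).le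
  have hSV : ∀ z ∈ Metric.closedBall (0 : EuclideanSpace ℝ (Fin d)) 1,
      S (T (k z)) ∈ V ∧ T (S (T (k z))) = T (k z) := fun z hz => by
    obtain ⟨q, hq, hqz⟩ := hkT z hz
    rw [← hqz, hST hq]
    exact ⟨hq, rfl⟩
  obtain ⟨z, hz, hz0⟩ := exists_eq_zero_of_dist_le_half
    (h := fun z => f (k z) - f (S (T (k z))))
    ((f.continuous.comp_continuousOn hkc).sub (f.continuous.comp_continuousOn
      (hS.comp (hTcont.comp_continuousOn hkc) hkT))) fun z hz => by
      have h1 := hdist (k z)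
      have h2 := hdist (S (T (k z)))
      rw [hf₀k z hz] at h1
      rw [hf₀V _ (hSV z hz).1, sub_zero] at h2
      calc _ = ‖(f (k z) - z) - f (S (T (k z)))‖ := by congr 1; abel
        _ ≤ _ := norm_sub_le _ _
        _ ≤ 1 / 2 := by linarith
  obtain ⟨n, hn⟩ := hobs (k z) (S (T (k z))) fun h => hVA _ (h ▸ (hSV z hz).1) (hkA z hz)
  refine hn ?_
  cases n with
  | zero => exact sub_eq_zero.1 hz0
  | succ n => rw [iterate_succ_apply, iterate_succ_apply, (hSV z hz).2]
end

section
/- Let T : X → X be a positively expansive continuous map on a compact metric space X and let m ≥ 1. If f ∈ C(X, ℝ^m) observes T, then f strictly observes T, i.e., there exists ε > 0 such that for all x ≠ y there is n ≥ 0 with ‖f(T^n x) − f(T^n y)‖ > ε. -/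
open Set Topology Function

/-- If `T` is a positively expansive map of a compact metric space and `f ∈ C(X, ℝ^m)`
observes `T`, then `f` strictly observes `T`. -/
theorem stmt4 {X : Type*} [MetricSpace X] [CompactSpace X]
    (T : X → X) (hTcont : Continuous T)
    (hexp : ∃ δ : ℝ, 0 < δ ∧ ∀ x y : X, x ≠ y → ∃ n : ℕ, δ < dist (T^[n] x) (T^[n] y))
    (m : ℕ) (hm : 1 ≤ m)
    (f : C(X, EuclideanSpace ℝ (Fin m)))
    (hobs : ∀ x y : X, x ≠ y → ∃ n : ℕ, f (T^[n] x) ≠ f (T^[n] y)) :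
    ∃ ε : ℝ, 0 < ε ∧ ∀ x y : X, x ≠ y → ∃ n : ℕ, ε < ‖f (T^[n] x) - f (T^[n] y)‖ := by
  obtain ⟨δ, hδ, hexp⟩ := hexp
  let U : ℕ → Set (X × X) := fun k =>
    ⋃ n : ℕ, {p | 1 / ((k : ℝ) + 1) < ‖f (T^[n] p.1) - f (T^[n] p.2)‖}
  have hK : IsCompact {p : X × X | δ ≤ dist p.1 p.2} :=
    (isClosed_le continuous_const continuous_dist).isCompact
  have hUo : ∀ k, IsOpen (U k) := fun k => isOpen_iUnion fun n =>
    isOpen_lt continuous_const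
      (((f.continuous.comp ((hTcont.iterate n).comp continuous_fst)).sub
        (f.continuous.comp ((hTcont.iterate n).comp continuous_snd))).norm)
  have hUmono : Monotone U := fun k l hkl =>
    iUnion_mono fun n p hp => lt_of_le_of_lt (b := 1 / ((k : ℝ) + 1)) (Nat.one_div_le_one_div hkl) hp
  have hcover : {p : X × X | δ ≤ dist p.1 p.2} ⊆ ⋃ k, U k := by
    rintro ⟨x, y⟩ hxy
    obtain ⟨n, hn⟩ := hobs x y (dist_pos.mp (hδ.trans_le hxy))
    obtain ⟨k, hk⟩ := exists_nat_one_div_lt (norm_pos_iff.mpr (sub_ne_zero.mpr hn))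
    exact mem_iUnion.mpr ⟨k, mem_iUnion.mpr ⟨n, hk⟩⟩
  obtain ⟨k, hk⟩ := hK.elim_directed_cover U hUo hcover hUmono.directed_le
  refine ⟨1 / ((k : ℝ) + 1), Nat.one_div_pos_of_nat, fun x y hxy => ?_⟩
  obtain ⟨i, hi⟩ := hexp x y hxy
  have hmem : (T^[i] x, T^[i] y) ∈ U k := hk hi.le
  obtain ⟨n, hn⟩ := mem_iUnion.mp hmem
  refine ⟨n + i, ?_⟩
  rw [iterate_add_apply, iterate_add_apply]
  exact hn
end

section
/- Let T : X → X be a continuous map of a compact metric space X with topological dimension dim X ≤ d. The following are equivalent: (1) T is positively expansive; (2) the set of f ∈ C(X, ℝ^{2d+1}) that strictly observe T is residual (comeager); (3) there exist m ≥ 1 and f ∈ C(X, ℝ^m) that strictly observes T. -/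
open Set Topology Function

/-- A finite family of points of an `N`-dimensional normed space can be perturbed into general
position: every affine dependency between at most `N + 1` of the new points is trivial. -/
theorem exists_generalPosition_near {E ι : Type*} [NormedAddCommGroup E] [NormedSpace ℝ E]
    [FiniteDimensional ℝ E] (p : ι → E) {η : ℝ} (hη : 0 < η) (s : Finset ι) :
    ∃ q : ι → E, (∀ i, dist (q i) (p i) < η) ∧
      ∀ c : ι → ℝ, ∀ t ⊆ s, t.card ≤ Module.finrank ℝ E + 1 → ∑ i ∈ t, c i = 0 →
        ∑ i ∈ t, c i • q i = 0 → ∀ i ∈ t, c i = 0 := by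
  classical
  induction s using Finset.induction_on with
  | empty =>
    refine ⟨p, fun i => by simpa using hη, fun c t ht _ _ _ i hi => ?_⟩
    exact absurd (ht hi) (Finset.notMem_empty i)
  | insert a s ha ih =>
    obtain ⟨q, hqp, hq⟩ := ih
    let _ : MeasurableSpace E := borel E
    have : BorelSpace E := ⟨rfl⟩
    let μ : MeasureTheory.Measure E := MeasureTheory.Measure.addHaar
    let 𝒯 : Finset (Finset ι) := s.powerset.filter fun t => t.card ≤ Module.finrank ℝ E
    have hproper : ∀ t ∈ 𝒯, affineSpan ℝ ((t.image q : Finset E) : Set E) ≠ ⊤ := by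
      intro t ht htop
      have hcard : (t.image q).card ≤ Module.finrank ℝ E :=
        Finset.card_image_le.trans (Finset.mem_filter.1 ht).2
      have hne : (t.image q).Nonempty := by
        have : ((t.image q : Finset E) : Set E).Nonempty := by
          rw [← affineSpan_nonempty (k := ℝ), htop]
          exact ⟨0, trivial⟩
        exact_mod_cast this
      have hdir : vectorSpan ℝ ((t.image q : Finset E) : Set E) = ⊤ := by
        rw [← direction_affineSpan, htop, AffineSubspace.direction_top]
      have hlt := finrank_vectorSpan_image_finset_le ℝ (id : E → E) (t.image q)
        (n := (t.image q).card - 1) (by have := hne.card_pos; omega)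
      rw [Finset.image_id, hdir, finrank_top] at hlt
      have := hne.card_pos
      omega
    have hnull : μ (⋃ t ∈ 𝒯, (affineSpan ℝ ((t.image q : Finset E) : Set E) : Set E)) = 0 :=
      (MeasureTheory.measure_biUnion_null_iff 𝒯.countable_toSet).2 fun t ht =>
        MeasureTheory.Measure.addHaar_affineSubspace μ _ (hproper t ht)
    obtain ⟨z, hzball, hz⟩ : ∃ z ∈ Metric.ball (p a) η,
        z ∉ ⋃ t ∈ 𝒯, (affineSpan ℝ ((t.image q : Finset E) : Set E) : Set E) := by
      by_contra! h
      exact (Metric.measure_ball_pos μ (p a) hη).ne' (MeasureTheory.measure_mono_null h hnull)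
    have hupd : ∀ t : Finset ι, a ∉ t → ∀ c : ι → ℝ,
        ∑ i ∈ t, c i • update q a z i = ∑ i ∈ t, c i • q i := by
      intro t hat c
      refine Finset.sum_congr rfl fun i hi => ?_
      rw [update_of_ne (ne_of_mem_of_not_mem hi hat)]
    refine ⟨update q a z, fun i => ?_, fun c t ht hcard hsum hcomb => ?_⟩
    · by_cases h : i = a
      · subst h; simpa using hzball
      · rw [update_of_ne h]; exact hqp i
    · by_cases hat : a ∈ t
      · have hes : t.erase a ⊆ s := fun i hi =>
          (Finset.mem_insert.1 (ht (Finset.mem_of_mem_erase hi))).resolve_left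
            (Finset.ne_of_mem_erase hi)
        have hecard : (t.erase a).card ≤ Module.finrank ℝ E := by
          rw [Finset.card_erase_of_mem hat]; omega
        rw [← Finset.add_sum_erase t _ hat] at hsum hcomb
        rw [hupd _ (Finset.notMem_erase a t), update_self] at hcomb
        have hca : c a = 0 := by
          by_contra hca
          refine hz (Set.mem_biUnion (x := t.erase a)
            (Finset.mem_coe.2 (Finset.mem_filter.2 ⟨Finset.mem_powerset.2 hes, hecard⟩)) ?_)
          have hw : ∑ i ∈ t.erase a, (-(c a)⁻¹ * c i) = 1 := by
            rw [← Finset.mul_sum, ← neg_eq_of_add_eq_zero_right hsum]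
            field_simp
          have hzeq : (t.erase a).affineCombination ℝ q (fun i => -(c a)⁻¹ * c i) = z := by
            rw [Finset.affineCombination_eq_linear_combination _ _ _ hw]
            simp_rw [mul_smul]
            rw [← Finset.smul_sum, ← neg_eq_of_add_eq_zero_right hcomb, smul_neg, neg_smul,
              neg_neg, smul_smul, inv_mul_cancel₀ hca, one_smul]
          rw [← hzeq, Finset.coe_image]
          exact affineCombination_mem_affineSpan_image hw (fun i hi hn => absurd hi hn) q
        rw [hca, zero_add] at hsum
        rw [hca, zero_smul, zero_add] at hcomb
        intro i hi
        by_cases h : i = a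
        · rw [h, hca]
        · exact hq c _ hes (by omega) hsum hcomb i (Finset.mem_erase.2 ⟨h, hi⟩)
      · rw [hupd t hat] at hcomb
        exact hq c t ((Finset.subset_insert_iff_of_notMem hat).1 ht) hcard hsum hcomb

/-- In a compact metric space of covering dimension at most `d`, there are finite open covers of
order at most `d + 1` by subsets of balls of prescribed radius. -/
theorem CovDimLE.exists_finite_cover {X : Type*} [MetricSpace X] [CompactSpace X] {d : ℕ}
    (hdim : CovDimLE X d) {r : ℝ} (hr : 0 < r) :
    ∃ 𝒲 : Finset (Set X), (∀ V ∈ 𝒲, IsOpen V) ∧ (∀ x, ∃ V ∈ 𝒲, x ∈ V) ∧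
      (∀ V ∈ 𝒲, ∃ z, V ⊆ Metric.ball z r) ∧
      ∀ x : X, {V ∈ (𝒲 : Set (Set X)) | x ∈ V}.ncard ≤ d + 1 := by
  obtain ⟨𝒱, ho, hcov, href, hord⟩ := hdim (Set.range fun z : X => Metric.ball z r)
    (by rintro _ ⟨z, rfl⟩; exact Metric.isOpen_ball)
    (Set.eq_univ_of_forall fun x => ⟨_, ⟨x, rfl⟩, Metric.mem_ball_self hr⟩)
  obtain ⟨𝒲, hsub⟩ := isCompact_univ.elim_finite_subcover (fun V : 𝒱 => (V : Set X))
    (fun V => ho V V.2) (by rw [← Set.sUnion_eq_iUnion, hcov])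
  classical
  have hmem : ∀ V ∈ 𝒲.image Subtype.val, V ∈ 𝒱 := by
    intro V hV
    obtain ⟨W, -, rfl⟩ := Finset.mem_image.1 hV
    exact W.2
  refine ⟨𝒲.image Subtype.val, fun V hV => ho V (hmem V hV), fun x => ?_, fun V hV => ?_,
    fun x => ?_⟩
  · obtain ⟨V, hV, hx⟩ := Set.mem_iUnion₂.1 (hsub (Set.mem_univ x))
    exact ⟨V, Finset.mem_image_of_mem _ hV, hx⟩
  · obtain ⟨_, ⟨z, rfl⟩, hz⟩ := href V (hmem V hV)
    exact ⟨z, hz⟩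
  · refine (Set.ncard_le_ncard (t := {V ∈ 𝒱 | x ∈ V}) ?_ (hord x).1).trans (hord x).2
    exact fun V hV => ⟨hmem V hV.1, hV.2⟩

/-- The Nöbeling density argument: maps into `ℝ^{2d+1}` separating all pairs at distance at least
`δ` are dense when the covering dimension is at most `d`. -/
theorem CovDimLE.exists_near_separating {X E : Type*} [MetricSpace X] [CompactSpace X]
    [NormedAddCommGroup E] [NormedSpace ℝ E] [FiniteDimensional ℝ E] {d : ℕ}
    (hdim : CovDimLE X d) (hE : 2 * d + 1 ≤ Module.finrank ℝ E) (f : C(X, E))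
    {δ η : ℝ} (hδ : 0 < δ) (hη : 0 < η) :
    ∃ g : C(X, E), dist g f < η ∧ ∀ x y, δ ≤ dist x y → g x ≠ g y := by
  classical
  obtain ⟨r₀, hr₀, hf⟩ := Metric.uniformContinuous_iff.1
    (CompactSpace.uniformContinuous_of_continuous f.continuous) (η / 4) (by positivity)
  obtain ⟨𝒲, ho, hcov, hball, hord⟩ := hdim.exists_finite_cover (lt_min hr₀ (half_pos hδ))
  choose z hz using fun V : 𝒲 => hball V V.2
  obtain ⟨φ, hφ⟩ := PartitionOfUnity.exists_isSubordinate (s := (Set.univ : Set X)) isClosed_univ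
    (fun V : 𝒲 => (V : Set X)) (fun V => ho V V.2)
    (fun x _ => by
      obtain ⟨V, hV, hx⟩ := hcov x
      exact Set.mem_iUnion.2 ⟨⟨V, hV⟩, hx⟩)
  have hφmem : ∀ V x, φ V x ≠ 0 → x ∈ (V : Set X) := fun V x h =>
    hφ V (subset_tsupport _ h)
  have hφsum : ∀ x, ∑ V, φ V x = 1 := fun x => by
    rw [← finsum_eq_sum_of_fintype]; exact φ.sum_eq_one (Set.mem_univ x)
  obtain ⟨q, hqp, hq⟩ := exists_generalPosition_near (fun V : 𝒲 => f (z V))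
    (show 0 < η / 4 by positivity) Finset.univ
  let g : C(X, E) := ⟨fun x => ∑ V, φ V x • q V, by fun_prop⟩
  have hg : ∀ x, g x = ∑ V, φ V x • q V := fun _ => rfl
  refine ⟨g, lt_of_le_of_lt ((ContinuousMap.dist_le (by positivity : 0 ≤ η / 2)).2 fun x => ?_)
    (half_lt_self hη), fun x y hxy hgxy => ?_⟩
  · have : g x - f x = ∑ V, φ V x • (q V - f x) := by
      simp_rw [smul_sub, Finset.sum_sub_distrib, ← Finset.sum_smul, hφsum, one_smul, hg]
    rw [dist_eq_norm, this]
    calc ‖∑ V, φ V x • (q V - f x)‖ ≤ ∑ V, φ V x * (η / 2) := by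
          refine norm_sum_le_of_le _ fun V _ => ?_
          rw [norm_smul, Real.norm_of_nonneg (φ.nonneg V x)]
          by_cases h : φ V x = 0
          · simp [h]
          · refine mul_le_mul_of_nonneg_left ?_ (φ.nonneg V x)
            have h1 := hf ((Metric.mem_ball'.1 (hz V (hφmem V x h))).trans_le (min_le_left _ _))
            rw [← dist_eq_norm]
            linarith [dist_triangle (q V) (f (z V)) (f x), hqp V]
      _ = η / 2 := by rw [← Finset.sum_mul, hφsum, one_mul]
  · let t : Finset 𝒲 := Finset.univ.filter fun V => x ∈ (V : Set X) ∨ y ∈ (V : Set X)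
    have htcard : t.card ≤ Module.finrank ℝ E + 1 := by
      have hle : ∀ w, (Finset.univ.filter fun V : 𝒲 => w ∈ (V : Set X)).card ≤ d + 1 := by
        intro w
        refine le_trans ?_ (hord w)
        rw [← Set.ncard_coe_finset, ← Set.ncard_image_of_injective _ Subtype.val_injective]
        refine Set.ncard_le_ncard ?_ (𝒲.finite_toSet.subset fun V hV => hV.1)
        rintro _ ⟨V, hV, rfl⟩
        exact ⟨V.2, (Finset.mem_filter.1 hV).2⟩
      have hunion := Finset.card_union_le (Finset.univ.filter fun V : 𝒲 => x ∈ (V : Set X))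
        (Finset.univ.filter fun V : 𝒲 => y ∈ (V : Set X))
      rw [← Finset.filter_or] at hunion
      linarith [hle x, hle y]
    have hoff : ∀ V ∉ t, φ V x - φ V y = 0 := by
      intro V hV
      simp only [t, Finset.mem_filter, Finset.mem_univ, true_and, not_or] at hV
      rw [not_not.1 (mt (hφmem V x) hV.1), not_not.1 (mt (hφmem V y) hV.2), sub_zero]
    have hzero : ∀ V ∈ t, φ V x - φ V y = 0 := by
      refine hq (fun V => φ V x - φ V y) t (Finset.subset_univ t) htcard ?_ ?_
      · rw [Finset.sum_subset (Finset.subset_univ t) fun V _ hV => hoff V hV,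
          Finset.sum_sub_distrib, hφsum, hφsum, sub_self]
      · rw [Finset.sum_subset (Finset.subset_univ t) fun V _ hV => by rw [hoff V hV, zero_smul]]
        simp_rw [sub_smul, Finset.sum_sub_distrib, ← hg, hgxy, sub_self]
    obtain ⟨V, -, hV⟩ := Finset.exists_ne_zero_of_sum_ne_zero (by rw [hφsum x]; exact one_ne_zero)
    have hVy : φ V y ≠ 0 := by
      have : φ V x - φ V y = 0 := by
        by_cases h : V ∈ t
        exacts [hzero V h, hoff V h]
      rwa [← sub_eq_zero.1 this]
    have h1 := (Metric.mem_ball.1 (hz V (hφmem V x hV))).trans_le (min_le_right _ _)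
    have h2 := (Metric.mem_ball'.1 (hz V (hφmem V y hVy))).trans_le (min_le_right _ _)
    linarith [dist_triangle x (z V) y]

/-- Maps into `ℝ^{2d+1}` that uniformly separate all pairs at distance at least `δ` are residual
when the covering dimension is at most `d`. -/
theorem CovDimLE.separating_mem_residual {X E : Type*} [MetricSpace X] [CompactSpace X]
    [NormedAddCommGroup E] [NormedSpace ℝ E] [FiniteDimensional ℝ E] {d : ℕ}
    (hdim : CovDimLE X d) (hE : 2 * d + 1 ≤ Module.finrank ℝ E) {δ : ℝ} (hδ : 0 < δ) :
    {f : C(X, E) | ∃ ε : ℝ, 0 < ε ∧ ∀ x y, δ ≤ dist x y → ε < ‖f x - f y‖} ∈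
      residual C(X, E) := by
  refine residual_of_dense_open ?_ ?_
  · refine Metric.isOpen_iff.2 fun f ⟨ε, hε, hf⟩ => ⟨ε / 4, by positivity, fun g hg =>
      ⟨ε / 2, by positivity, fun x y hxy => ?_⟩⟩
    have h1 := (ContinuousMap.dist_apply_le_dist (f := f) (g := g) x).trans_lt
      (Metric.mem_ball'.1 hg)
    have h2 := (ContinuousMap.dist_apply_le_dist (f := g) (g := f) y).trans_lt
      (Metric.mem_ball.1 hg)
    have h3 := hf x y hxy
    rw [← dist_eq_norm] at h3 ⊢
    linarith [dist_triangle4 (f x) (g x) (g y) (f y)]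
  · refine Metric.dense_iff.2 fun f η hη => ?_
    obtain ⟨g, hg, hsep⟩ := hdim.exists_near_separating hE f hδ hη
    refine ⟨g, hg, ?_⟩
    have hK : IsCompact {w : X × X | δ ≤ dist w.1 w.2} :=
      (isClosed_le continuous_const continuous_dist).isCompact
    obtain ⟨ε, hε, hle⟩ := hK.exists_forall_le' (f := fun w => ‖g w.1 - g w.2‖) (a := 0)
      (by fun_prop) fun w hw => norm_pos_iff.2 (sub_ne_zero.2 (hsep _ _ hw))
    exact ⟨ε / 2, by positivity, fun x y hxy => (half_lt_self hε).trans_le (hle (x, y) hxy)⟩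

/-- For a continuous map `T` of a compact metric space `X` with `dim X ≤ d`, the following
are equivalent: (1) `T` is positively expansive; (2) a residual set of `f ∈ C(X, ℝ^{2d+1})`
strictly observes `T`; (3) some `f ∈ C(X, ℝ^m)` strictly observes `T`, for some `m ≥ 1`. -/
theorem stmt5 {X : Type*} [MetricSpace X] [CompactSpace X] (d : ℕ)
    (T : X → X) (hTcont : Continuous T)
    (hdim : CovDimLE X d) :
    ((∃ δ : ℝ, 0 < δ ∧ ∀ x y : X, x ≠ y → ∃ n : ℕ, δ < dist (T^[n] x) (T^[n] y)) ↔
      {f : C(X, EuclideanSpace ℝ (Fin (2 * d + 1))) |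
          ∃ ε : ℝ, 0 < ε ∧ ∀ x y : X, x ≠ y →
            ∃ n : ℕ, ε < ‖f (T^[n] x) - f (T^[n] y)‖} ∈
        residual C(X, EuclideanSpace ℝ (Fin (2 * d + 1)))) ∧
    ({f : C(X, EuclideanSpace ℝ (Fin (2 * d + 1))) |
          ∃ ε : ℝ, 0 < ε ∧ ∀ x y : X, x ≠ y →
            ∃ n : ℕ, ε < ‖f (T^[n] x) - f (T^[n] y)‖} ∈
        residual C(X, EuclideanSpace ℝ (Fin (2 * d + 1))) ↔
      ∃ m : ℕ, 1 ≤ m ∧ ∃ f : C(X, EuclideanSpace ℝ (Fin m)),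
        ∃ ε : ℝ, 0 < ε ∧ ∀ x y : X, x ≠ y →
          ∃ n : ℕ, ε < ‖f (T^[n] x) - f (T^[n] y)‖) := by
  have hresidual : (∃ δ : ℝ, 0 < δ ∧ ∀ x y : X, x ≠ y → ∃ n : ℕ, δ < dist (T^[n] x) (T^[n] y)) →
      {f : C(X, EuclideanSpace ℝ (Fin (2 * d + 1))) |
          ∃ ε : ℝ, 0 < ε ∧ ∀ x y : X, x ≠ y →
            ∃ n : ℕ, ε < ‖f (T^[n] x) - f (T^[n] y)‖} ∈
        residual C(X, EuclideanSpace ℝ (Fin (2 * d + 1))) := by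
    rintro ⟨δ, hδ, hexp⟩
    refine Filter.mem_of_superset (hdim.separating_mem_residual (by simp) hδ) ?_
    rintro f ⟨ε, hε, hf⟩
    refine ⟨ε, hε, fun x y hxy => ?_⟩
    obtain ⟨n, hn⟩ := hexp x y hxy
    exact ⟨n, hf _ _ hn.le⟩
  have hobserve : {f : C(X, EuclideanSpace ℝ (Fin (2 * d + 1))) |
          ∃ ε : ℝ, 0 < ε ∧ ∀ x y : X, x ≠ y →
            ∃ n : ℕ, ε < ‖f (T^[n] x) - f (T^[n] y)‖} ∈
        residual C(X, EuclideanSpace ℝ (Fin (2 * d + 1))) →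
      ∃ m : ℕ, 1 ≤ m ∧ ∃ f : C(X, EuclideanSpace ℝ (Fin m)),
        ∃ ε : ℝ, 0 < ε ∧ ∀ x y : X, x ≠ y →
          ∃ n : ℕ, ε < ‖f (T^[n] x) - f (T^[n] y)‖ := fun h => by
    obtain ⟨f, hf⟩ := (dense_of_mem_residual h).nonempty
    exact ⟨2 * d + 1, by omega, f, hf⟩
  have hexpansive : (∃ m : ℕ, 1 ≤ m ∧ ∃ f : C(X, EuclideanSpace ℝ (Fin m)),
        ∃ ε : ℝ, 0 < ε ∧ ∀ x y : X, x ≠ y →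
          ∃ n : ℕ, ε < ‖f (T^[n] x) - f (T^[n] y)‖) →
      ∃ δ : ℝ, 0 < δ ∧ ∀ x y : X, x ≠ y → ∃ n : ℕ, δ < dist (T^[n] x) (T^[n] y) := by
    rintro ⟨m, -, f, ε, hε, hobs⟩
    obtain ⟨δ, hδ, hf⟩ := Metric.uniformContinuous_iff.1
      (CompactSpace.uniformContinuous_of_continuous f.continuous) ε hε
    refine ⟨δ / 2, by positivity, fun x y hxy => ?_⟩
    obtain ⟨n, hn⟩ := hobs x y hxy
    refine ⟨n, (half_lt_self hδ).trans_le (not_lt.1 fun h => ?_)⟩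
    exact (hn.trans (dist_eq_norm (f (T^[n] x)) _ ▸ hf h)).false
  exact ⟨⟨hresidual, fun h => hexpansive (hobserve h)⟩, hobserve, fun h => hresidual (hexpansive h)⟩
end
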